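/- Let p ≥ 2, c > 0, and assume A_{i,j} ≥ κ hᵢ for all i, j with κ > 0, and that the partition is σ-shape-regular (max hᵢ ≤ σ min hᵢ). Let u ∈ W̃_β^{2p+1,∞} be an exact solution of −(βu′)′ + γu′ + cu = f on (a,α) ∪ (α,b) with u(a) = u(b) = 0, and let u_T ∈ U_T be an IFVM solution with the same data f. Then there exist h₀ > 0 and C > 0, depending only on p, β⁻, β⁺, γ, c, κ, σ and b−a, such that for h ≤ h₀ the flux is superconvergent at the generalized Gauss points: |β(g_{i,j}) (u′(g_{i,j}) − u_T′(g_{i,j}))| ≤ C h^{p+1} ‖u‖_{2p+1,∞} for all 1 ≤ i ≤ N and 1 ≤ j ≤ p. -/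

import Mathlib

open Set

/-- The piecewise-constant diffusion coefficient with interface point `α`. -/
noncomputable def betaPW (βm βp α : ℝ) : ℝ → ℝ := fun t => if t < α then βm else βp

/-- Membership in the immersed trial space `U_T`: continuous on `[a,b]`, zero boundary
values, a polynomial of degree ≤ p on each non-interface element `[x_{i-1}, x_i]` (i ≠ k),
and on the interface element `[x_{k-1}, x_k]` a continuous piecewise polynomial of degree ≤ p
satisfying the derivative jump conditions at the interface `α`. -/
def MemUT (p N k : ℕ) (a b α βm βp : ℝ) (x : ℕ → ℝ) (v : ℝ → ℝ) : Prop :=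
  ContinuousOn v (Set.Icc a b) ∧ v a = 0 ∧ v b = 0 ∧
  (∀ i, 1 ≤ i → i ≤ N → i ≠ k → ∃ q : Polynomial ℝ, q.natDegree ≤ p ∧
    ∀ y ∈ Set.Icc (x (i - 1)) (x i), v y = q.eval y) ∧
  ∃ qm qp : Polynomial ℝ, qm.natDegree ≤ p ∧ qp.natDegree ≤ p ∧
    (∀ y ∈ Set.Icc (x (k - 1)) α, v y = qm.eval y) ∧
    (∀ y ∈ Set.Icc α (x k), v y = qp.eval y) ∧
    ∀ j, 1 ≤ j → j ≤ p →
      βm * ((⇑Polynomial.derivative)^[j] qm).eval α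
        = βp * ((⇑Polynomial.derivative)^[j] qp).eval α

/-- Membership in `W̃_β^{m,∞}`: continuous on `[a,b]`, zero boundary values, `C^m` on each
of `[a,α]` and `[α,b]`, and satisfying the flux jump conditions at `α` for `j = 1,…,m`. -/
def MemW (m : ℕ) (a b α βm βp : ℝ) (u : ℝ → ℝ) : Prop :=
  ContinuousOn u (Set.Icc a b) ∧ u a = 0 ∧ u b = 0 ∧
  ContDiffOn ℝ (m : ℕ∞) u (Set.Icc a α) ∧ ContDiffOn ℝ (m : ℕ∞) u (Set.Icc α b) ∧
  ∀ j, 1 ≤ j → j ≤ m →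
    βm * iteratedDerivWithin j u (Set.Icc a α) α
      = βp * iteratedDerivWithin j u (Set.Icc α b) α

/-- The broken `W^{m,∞}` norm `‖u‖_{m,∞}`: maximum of the piecewise `W^{m,∞}` norms on
`[a,α]` and `[α,b]`. -/
noncomputable def wnorm (m : ℕ) (a b α : ℝ) (u : ℝ → ℝ) : ℝ :=
  max (sSup {y : ℝ | ∃ j ≤ m, ∃ t ∈ Set.Icc a α,
        y = |iteratedDerivWithin j u (Set.Icc a α) t|})
      (sSup {y : ℝ | ∃ j ≤ m, ∃ t ∈ Set.Icc α b,
        y = |iteratedDerivWithin j u (Set.Icc α b) t|})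

/-- Mean value inequality allowing one exceptional interior point. -/
lemma mul_sub_le_of_le_deriv_off_point {F F' : ℝ → ℝ} {l r α m : ℝ} (hlr : l ≤ r)
    (hF : ContinuousOn F (Icc l r))
    (hF' : ∀ t ∈ Ioo l r, t ≠ α → HasDerivAt F (F' t) t)
    (hm : ∀ t ∈ Ioo l r, t ≠ α → m ≤ F' t) : m * (r - l) ≤ F r - F l := by
  have key : ∀ l' r', l ≤ l' → r' ≤ r → l' ≤ r' → α ∉ Ioo l' r' →
      m * (r' - l') ≤ F r' - F l' := by
    intro l' r' hl hr hlr' hα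
    have hsub : ∀ t ∈ Ioo l' r', HasDerivAt F (F' t) t ∧ m ≤ F' t := fun t ht =>
      have hne : t ≠ α := fun h => hα (h ▸ ht)
      have hmem : t ∈ Ioo l r := ⟨hl.trans_lt ht.1, ht.2.trans_le hr⟩
      ⟨hF' t hmem hne, hm t hmem hne⟩
    refine (convex_Icc l' r').mul_sub_le_image_sub_of_le_deriv
      (hF.mono (Icc_subset_Icc hl hr)) ?_ ?_ l' (left_mem_Icc.2 hlr') r'
      (right_mem_Icc.2 hlr') hlr'
    · rw [interior_Icc]
      exact fun t ht => (hsub t ht).1.differentiableAt.differentiableWithinAt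
    · rw [interior_Icc]
      intro t ht
      rw [(hsub t ht).1.deriv]
      exact (hsub t ht).2
  by_cases hα : α ∈ Ioo l r
  · have h1 := key l α le_rfl hα.2.le hα.1.le (fun h => lt_irrefl _ h.2)
    have h2 := key α r hα.1.le le_rfl hα.2.le (fun h => lt_irrefl _ h.1)
    linarith
  · exact key l r le_rfl le_rfl hlr hα

lemma abs_sub_le_of_abs_deriv_le_off_point {F F' : ℝ → ℝ} {l r α M : ℝ} (hlr : l ≤ r)
    (hF : ContinuousOn F (Icc l r))
    (hF' : ∀ t ∈ Ioo l r, t ≠ α → HasDerivAt F (F' t) t)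
    (hM : ∀ t ∈ Ioo l r, t ≠ α → |F' t| ≤ M) : |F r - F l| ≤ M * (r - l) := by
  have h1 := mul_sub_le_of_le_deriv_off_point (m := -M) hlr hF hF'
    (fun t ht hne => (abs_le.1 (hM t ht hne)).1)
  have h2 := mul_sub_le_of_le_deriv_off_point (F := fun t => -F t) (F' := fun t => -F' t)
    (m := -M) hlr hF.neg (fun t ht hne => (hF' t ht hne).neg)
    (fun t ht hne => neg_le_neg (abs_le.1 (hM t ht hne)).2)
  rw [abs_le]
  constructor <;> linarith

lemma exists_antiderivative (q : Polynomial ℝ) :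
    ∃ P : Polynomial ℝ, P.natDegree ≤ q.natDegree + 1 ∧ Polynomial.derivative P = q := by
  refine ⟨∑ i ∈ Finset.range (q.natDegree + 1),
    Polynomial.C (q.coeff i / (i + 1)) * Polynomial.X ^ (i + 1), ?_, ?_⟩
  · refine Polynomial.natDegree_sum_le_of_forall_le _ _ fun i hi => ?_
    refine (Polynomial.natDegree_C_mul_X_pow_le _ _).trans ?_
    have := Finset.mem_range.1 hi
    omega
  · conv_rhs => rw [q.as_sum_range_C_mul_X_pow]
    rw [Polynomial.derivative_sum]
    refine Finset.sum_congr rfl fun i _ => ?_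
    rw [Polynomial.derivative_C_mul_X_pow]
    congr 2
    push_cast
    have : (i : ℝ) + 1 ≠ 0 := by positivity
    field_simp

/-- The Taylor polynomial of degree `n` with base point `x₀` whose derivatives at the base point
are prescribed by `D`. -/
noncomputable def taylorPoly (D : ℕ → ℝ) (x₀ : ℝ) (n : ℕ) : Polynomial ℝ :=
  ∑ i ∈ Finset.range (n + 1),
    Polynomial.C (D i / (i.factorial : ℝ)) * (Polynomial.X - Polynomial.C x₀) ^ i

lemma natDegree_taylorPoly_le (D : ℕ → ℝ) (x₀ : ℝ) (n : ℕ) :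
    (taylorPoly D x₀ n).natDegree ≤ n := by
  refine Polynomial.natDegree_sum_le_of_forall_le _ _ fun i hi => ?_
  refine (Polynomial.natDegree_C_mul_le _ _).trans ?_
  rw [Polynomial.natDegree_pow, Polynomial.natDegree_X_sub_C]
  have := Finset.mem_range.1 hi
  omega

lemma eval_taylorPoly_self (D : ℕ → ℝ) (x₀ : ℝ) (n : ℕ) :
    (taylorPoly D x₀ n).eval x₀ = D 0 := by
  simp [taylorPoly, Polynomial.eval_finsetSum, Finset.sum_range_succ']

lemma derivative_taylorPoly (D : ℕ → ℝ) (x₀ : ℝ) (n : ℕ) :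
    Polynomial.derivative (taylorPoly D x₀ (n + 1)) = taylorPoly (fun i => D (i + 1)) x₀ n := by
  unfold taylorPoly
  rw [Finset.sum_range_succ', Polynomial.derivative_add, Polynomial.derivative_sum]
  simp only [pow_zero, mul_one, Polynomial.derivative_C, add_zero]
  refine Finset.sum_congr rfl fun i _ => ?_
  rw [Polynomial.derivative_C_mul, Polynomial.derivative_X_sub_C_pow, ← mul_assoc,
    Nat.add_sub_cancel, ← Polynomial.C_mul]
  congr 2
  rw [Nat.factorial_succ]
  push_cast
  have : (i : ℝ) + 1 ≠ 0 := by positivity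
  field_simp

/-- Taylor's theorem on a segment with an arbitrary base point in it. -/
lemma abs_sub_eval_taylorPoly_le {l r M x₀ : ℝ} (hlr : l < r) (hx₀ : x₀ ∈ Icc l r) (n : ℕ) :
    ∀ f : ℝ → ℝ, ContDiffOn ℝ (n + 1 : ℕ) f (Icc l r) →
      (∀ y ∈ Icc l r, |iteratedDerivWithin (n + 1) f (Icc l r) y| ≤ M) →
      ∀ x ∈ Icc l r,
        |f x - (taylorPoly (fun i => iteratedDerivWithin i f (Icc l r) x₀) x₀ n).eval x|
          ≤ M * |x - x₀| ^ (n + 1) := by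
  have hM0 : ∀ g : ℝ → ℝ, (∀ y ∈ Icc l r, |g y| ≤ M) → 0 ≤ M := fun g hg =>
    (abs_nonneg _).trans (hg x₀ hx₀)
  have step : ∀ (f : ℝ → ℝ) (Q : Polynomial ℝ) (B x : ℝ), x ∈ Icc l r → f x₀ = Q.eval x₀ →
      DifferentiableOn ℝ f (Icc l r) →
      (∀ y ∈ Icc l r, |y - x₀| ≤ |x - x₀| →
        |derivWithin f (Icc l r) y - (Polynomial.derivative Q).eval y| ≤ B) →
      |f x - Q.eval x| ≤ B * |x - x₀| := by
    intro f Q B x hx h0 hd hB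
    have hsub : uIcc x₀ x ⊆ Icc l r := uIcc_subset_Icc hx₀ hx
    have h := (convex_uIcc x₀ x).norm_image_sub_le_of_norm_hasDerivWithin_le
      (f := fun y => f y - Q.eval y)
      (f' := fun y => derivWithin f (Icc l r) y - (Polynomial.derivative Q).eval y) (C := B)
      (fun y hy => ((hd y (hsub hy)).hasDerivWithinAt.mono hsub).sub
        (Q.hasDerivAt y).hasDerivWithinAt)
      (fun y hy => hB y (hsub hy) (abs_sub_left_of_mem_uIcc hy)) left_mem_uIcc right_mem_uIcc
    simpa [h0] using h
  induction n with
  | zero =>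
    intro f hf hM x hx
    have h := step f (taylorPoly (fun i => iteratedDerivWithin i f (Icc l r) x₀) x₀ 0) M x hx
      (by rw [eval_taylorPoly_self, iteratedDerivWithin_zero])
      (hf.differentiableOn (by norm_num)) (fun y hy _ => by
        have := hM y hy
        rw [zero_add, iteratedDerivWithin_one] at this
        simpa [taylorPoly] using this)
    simpa using h
  | succ n ih =>
    intro f hf hM x hx
    have hu := uniqueDiffOn_Icc hlr
    have hM' : 0 ≤ M := hM0 _ hM
    have h := step f (taylorPoly (fun i => iteratedDerivWithin i f (Icc l r) x₀) x₀ (n + 1))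
      (M * |x - x₀| ^ (n + 1)) x hx
      (by rw [eval_taylorPoly_self, iteratedDerivWithin_zero])
      (hf.differentiableOn (by simp)) (fun y hy hyx => by
        rw [derivative_taylorPoly]
        have := ih (derivWithin f (Icc l r)) (hf.derivWithin hu (by push_cast; exact le_rfl))
          (by simpa only [← iteratedDerivWithin_succ'] using hM) y hy
        simp only [← iteratedDerivWithin_succ'] at this
        exact this.trans (by gcongr))
    rwa [mul_assoc, ← pow_succ] at h

/-- Inverse inequality between the sup norm and the `L²` norm of polynomials of degree `≤ n`. -/
lemma exists_sq_eval_le_integral_sq (n : ℕ) : ∃ C : ℝ, 0 < C ∧ ∀ (l r : ℝ) (B : Polynomial ℝ),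
    l < r → B.natDegree ≤ n → ∀ t ∈ Icc l r,
      B.eval t ^ 2 * (r - l) ≤ C * ∫ s in l..r, B.eval s ^ 2 := by
  classical
  let ev : (Fin (n + 1) → ℝ) → ℝ → ℝ := fun v s => ∑ i, v i * s ^ (i : ℕ)
  let Φ : (Fin (n + 1) → ℝ) → ℝ := fun v => ∫ s in (0 : ℝ)..1, ev v s ^ 2
  have hevc : Continuous (Function.uncurry fun v s => ev v s ^ 2) := by
    simp only [ev, Function.uncurry_def]
    fun_prop
  have hΦc : Continuous Φ :=
    intervalIntegral.continuous_parametric_intervalIntegral_of_continuous' hevc 0 1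
  have hpos : ∀ v ∈ Metric.sphere (0 : Fin (n + 1) → ℝ) 1, 0 < Φ v := by
    intro v hv
    have hc : Continuous fun s => ev v s ^ 2 := by
      simp only [ev]
      fun_prop
    by_contra hle
    have hne : ∃ s ∈ Icc (0 : ℝ) 1, ev v s ≠ 0 := by
      by_contra! hall
      let P : Polynomial ℝ := ∑ i : Fin (n + 1), Polynomial.C (v i) * Polynomial.X ^ (i : ℕ)
      have hP : P = 0 := by
        refine Polynomial.eq_zero_of_infinite_isRoot P
          ((Icc_infinite (zero_lt_one' ℝ)).mono fun s hs => ?_)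
        have := hall s hs
        simpa [P, ev, Polynomial.IsRoot, Polynomial.eval_finsetSum] using this
      have hv0 : v = 0 := by
        funext j
        have := congrArg (fun Q => Polynomial.coeff Q (j : ℕ)) hP
        simpa [P, Polynomial.finsetSum_coeff, Polynomial.coeff_C_mul, Polynomial.coeff_X_pow,
          Fin.val_inj] using this
      simp [hv0] at hv
    obtain ⟨s, hs, hs0⟩ := hne
    exact hle (intervalIntegral.integral_pos zero_lt_one hc.continuousOn
      (fun _ _ => sq_nonneg _) ⟨s, hs, by positivity⟩)
  obtain ⟨v₀, hv₀, hmin⟩ := (isCompact_sphere (0 : Fin (n + 1) → ℝ) 1).exists_isMinOn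
    ⟨Function.const _ 1, by simp⟩ hΦc.continuousOn
  have hm := hpos v₀ hv₀
  have hhom : ∀ v, Φ v₀ * ‖v‖ ^ 2 ≤ Φ v := by
    intro v
    by_cases hv : v = 0
    · subst hv
      simp [Φ, ev]
    have hnv : 0 < ‖v‖ := norm_pos_iff.2 hv
    have h := hmin (a := ‖v‖⁻¹ • v) (by simp [norm_smul, hnv.ne'])
    have hsc : Φ (‖v‖⁻¹ • v) = ‖v‖⁻¹ ^ 2 * Φ v := by
      simp only [Φ, ← intervalIntegral.integral_const_mul]
      refine intervalIntegral.integral_congr fun s _ => ?_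
      simp only [ev, Pi.smul_apply, smul_eq_mul, mul_assoc, ← Finset.mul_sum]
      ring
    simp only [mem_ofPred_eq, hsc] at h
    calc Φ v₀ * ‖v‖ ^ 2 ≤ ‖v‖⁻¹ ^ 2 * Φ v * ‖v‖ ^ 2 := by gcongr
      _ = Φ v := by field_simp
  refine ⟨(n + 1) ^ 2 / Φ v₀, by positivity, fun l r B hlr hB t ht => ?_⟩
  have hh : 0 < r - l := sub_pos.2 hlr
  let P : Polynomial ℝ := B.comp (Polynomial.C l + Polynomial.C (r - l) * Polynomial.X)
  have hPdeg : P.natDegree ≤ n := by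
    refine Polynomial.natDegree_comp_le.trans ?_
    have : (Polynomial.C l + Polynomial.C (r - l) * Polynomial.X).natDegree ≤ 1 := by
      compute_degree
    calc _ ≤ n * 1 := Nat.mul_le_mul hB this
      _ = n := mul_one n
  let v : Fin (n + 1) → ℝ := fun i => P.coeff i
  have hPev : ∀ s, ev v s = B.eval (l + (r - l) * s) := by
    intro s
    have h1 : P.eval s = B.eval (l + (r - l) * s) := by simp [P, Polynomial.eval_comp]
    rw [← h1, Polynomial.eval_eq_sum_range' (Nat.lt_succ_of_le hPdeg), ← Fin.sum_univ_eq_sum_range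
      (fun i => P.coeff i * s ^ i)]
  have hint : Φ v * (r - l) = ∫ s in l..r, B.eval s ^ 2 := by
    have h := intervalIntegral.integral_comp_add_mul (fun y => B.eval y ^ 2) hh.ne' l
      (a := 0) (b := 1)
    simp only [mul_zero, add_zero, mul_one, add_sub_cancel, smul_eq_mul] at h
    simp only [Φ, hPev, h]
    field_simp
  have hsup : |B.eval t| ≤ (n + 1) * ‖v‖ := by
    have ht' : B.eval t = ev v ((t - l) / (r - l)) := by
      rw [hPev]
      congr 1
      field_simp
      ring
    have hs0 : 0 ≤ (t - l) / (r - l) := div_nonneg (sub_nonneg.2 ht.1) hh.le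
    have hs1 : (t - l) / (r - l) ≤ 1 := (div_le_one hh).2 (by linarith [ht.2])
    rw [ht']
    calc |ev v ((t - l) / (r - l))|
        ≤ ∑ i : Fin (n + 1), |v i * ((t - l) / (r - l)) ^ (i : ℕ)| :=
          Finset.abs_sum_le_sum_abs _ _
      _ ≤ ∑ _i : Fin (n + 1), ‖v‖ := by
          refine Finset.sum_le_sum fun i _ => ?_
          rw [abs_mul, abs_pow, abs_of_nonneg hs0]
          exact (mul_le_of_le_one_right (abs_nonneg _) (pow_le_one₀ hs0 hs1)).trans
            (norm_le_pi_norm v i)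
      _ = (n + 1) * ‖v‖ := by simp
  rw [← hint]
  have hsq : B.eval t ^ 2 ≤ (n + 1) ^ 2 * ‖v‖ ^ 2 := by
    rw [← sq_abs, ← mul_pow]
    gcongr
  calc B.eval t ^ 2 * (r - l) ≤ (n + 1) ^ 2 * ‖v‖ ^ 2 * (r - l) := by gcongr
    _ = (n + 1) ^ 2 / Φ v₀ * (Φ v₀ * ‖v‖ ^ 2 * (r - l)) := by field_simp
    _ ≤ (n + 1) ^ 2 / Φ v₀ * (Φ v * (r - l)) := by
        gcongr
        exact hhom v

lemma min_le_betaPW (βm βp α t : ℝ) : min βm βp ≤ betaPW βm βp α t := by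
  unfold betaPW
  split_ifs
  exacts [min_le_left _ _, min_le_right _ _]

lemma betaPW_le_max (βm βp α t : ℝ) : betaPW βm βp α t ≤ max βm βp := by
  unfold betaPW
  split_ifs
  exacts [le_max_left _ _, le_max_right _ _]

lemma betaPW_pos {βm βp : ℝ} (hβm : 0 < βm) (hβp : 0 < βp) (α t : ℝ) :
    0 < betaPW βm βp α t :=
  (lt_min hβm hβp).trans_le (min_le_betaPW _ _ _ _)

lemma betaPW_of_lt {βm βp α t : ℝ} (h : t < α) : betaPW βm βp α t = βm := if_pos h

lemma betaPW_of_gt {βm βp α t : ℝ} (h : α < t) : betaPW βm βp α t = βp := if_neg h.not_gt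

lemma measurable_betaPW (βm βp α : ℝ) : Measurable (betaPW βm βp α) :=
  Measurable.ite measurableSet_Iio measurable_const measurable_const

lemma eventuallyEq_betaPW {βm βp α t : ℝ} (h : t ≠ α) :
    betaPW βm βp α =ᶠ[nhds t] fun _ => betaPW βm βp α t := by
  rcases h.lt_or_gt with h | h
  · filter_upwards [Iio_mem_nhds h] with s hs
    rw [betaPW_of_lt h, betaPW_of_lt hs]
  · filter_upwards [Ioi_mem_nhds h] with s hs
    rw [betaPW_of_gt h, betaPW_of_gt hs]

lemma continuousAt_betaPW {βm βp α t : ℝ} (h : t ≠ α) : ContinuousAt (betaPW βm βp α) t :=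
  continuousAt_const.congr (eventuallyEq_betaPW h).symm

lemma intervalIntegrable_div_betaPW {βm βp : ℝ} (hβm : 0 < βm) (hβp : 0 < βp)
    {w : ℝ → ℝ} (hw : Continuous w) (α l r : ℝ) :
    IntervalIntegrable (fun t => w t / betaPW βm βp α t) MeasureTheory.volume l r := by
  have hinv : IntervalIntegrable (fun t => (betaPW βm βp α t)⁻¹) MeasureTheory.volume l r := by
    refine (intervalIntegrable_const (c := (min βm βp)⁻¹)).mono_fun
      (measurable_betaPW βm βp α).inv.aestronglyMeasurable (Filter.Eventually.of_forall fun t => ?_)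
    have h0 := lt_min hβm hβp
    have h1 := betaPW_pos hβm hβp α t
    beta_reduce
    rw [Real.norm_of_nonneg (inv_pos.2 h1).le, Real.norm_of_nonneg (inv_pos.2 h0).le]
    exact inv_anti₀ h0 (min_le_betaPW _ _ _ _)
  simpa only [div_eq_mul_inv] using hinv.continuousOn_mul hw.continuousOn

lemma hasDerivAt_integral_div_betaPW {βm βp : ℝ} (hβm : 0 < βm) (hβp : 0 < βp)
    {w : ℝ → ℝ} (hw : Continuous w) {α t : ℝ} (l : ℝ)
    (ht : t ≠ α) : HasDerivAt (fun x => ∫ s in l..x, w s / betaPW βm βp α s)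
      (w t / betaPW βm βp α t) t :=
  intervalIntegral.integral_hasDerivAt_right (intervalIntegrable_div_betaPW hβm hβp hw α l t)
    (hw.measurable.div (measurable_betaPW βm βp α)).stronglyMeasurable.stronglyMeasurableAtFilter
    (hw.continuousAt.div (continuousAt_betaPW ht) (betaPW_pos hβm hβp α t).ne')

lemma continuous_integral_div_betaPW {βm βp : ℝ} (hβm : 0 < βm) (hβp : 0 < βp)
    {w : ℝ → ℝ} (hw : Continuous w) (α l : ℝ) :
    Continuous fun x => ∫ s in l..x, w s / betaPW βm βp α s :=
  intervalIntegral.continuous_primitive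
    (fun l' r' => intervalIntegrable_div_betaPW hβm hβp hw α l' r') l

lemma integral_div_betaPW_le {βm βp : ℝ} (hβm : 0 < βm) (hβp : 0 < βp)
    {α l r : ℝ} (hlr : l ≤ r) :
    ∫ t in l..r, 1 / betaPW βm βp α t ≤ (r - l) / min βm βp := by
  calc ∫ t in l..r, 1 / betaPW βm βp α t ≤ ∫ _t in l..r, 1 / min βm βp := by
        refine intervalIntegral.integral_mono_on hlr
          (intervalIntegrable_div_betaPW hβm hβp continuous_const α l r)
          intervalIntegrable_const fun t _ => ?_
        exact one_div_le_one_div_of_le (lt_min hβm hβp) (min_le_betaPW _ _ _ _)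
    _ = (r - l) / min βm βp := by
        rw [intervalIntegral.integral_const, smul_eq_mul, mul_one_div]

lemma sum_weights_le {βm βp : ℝ} (hβm : 0 < βm) (hβp : 0 < βp)
    {α l r : ℝ} {p : ℕ} {g A : ℕ → ℝ} (hlr : l ≤ r)
    (hQ : ∀ F : Polynomial ℝ, F.natDegree ≤ 2 * p - 1 →
      ∑ j ∈ Finset.Icc 1 p, A j * F.eval (g j) = ∫ t in l..r, F.eval t / betaPW βm βp α t) :
    ∑ j ∈ Finset.Icc 1 p, A j ≤ (r - l) / min βm βp := by
  have h := hQ 1 (by simp)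
  simp only [Polynomial.eval_one, mul_one] at h
  rw [h]
  exact integral_div_betaPW_le hβm hβp hlr

/-- Polynomials of degree `≤ p - 1` are controlled by their values at the Gauss points. -/
lemma exists_lebesgue_constant {βm βp : ℝ} (hβm : 0 < βm) (hβp : 0 < βp)
    (p : ℕ) : ∃ Λ : ℝ, 0 < Λ ∧
    ∀ (α l r δ : ℝ) (g A : ℕ → ℝ) (B : Polynomial ℝ), l < r →
      (∀ j ∈ Finset.Icc 1 p, 0 < A j) →
      (∀ F : Polynomial ℝ, F.natDegree ≤ 2 * p - 1 →
        ∑ j ∈ Finset.Icc 1 p, A j * F.eval (g j) = ∫ t in l..r, F.eval t / betaPW βm βp α t) →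
      B.natDegree ≤ p - 1 → 0 ≤ δ → (∀ j ∈ Finset.Icc 1 p, |B.eval (g j)| ≤ δ) →
      ∀ t ∈ Icc l r, |B.eval t| ≤ Λ * δ := by
  obtain ⟨C, hC, hinv⟩ := exists_sq_eval_le_integral_sq (p - 1)
  have hlo := lt_min hβm hβp
  have hhi : 0 < max βm βp := lt_max_of_lt_left hβm
  refine ⟨√(C * max βm βp / min βm βp), by positivity, ?_⟩
  intro α l r δ g A B hlr hA hQ hB hδ hBg t ht
  have hh : 0 < r - l := sub_pos.2 hlr
  have h1 := hinv l r B hlr hB t ht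
  have hcont : Continuous fun s => B.eval s ^ 2 := by fun_prop
  have h2 : ∫ s in l..r, B.eval s ^ 2
      ≤ max βm βp * ∫ s in l..r, B.eval s ^ 2 / betaPW βm βp α s := by
    rw [← intervalIntegral.integral_const_mul]
    refine intervalIntegral.integral_mono_on hlr.le (hcont.intervalIntegrable _ _)
      ((intervalIntegrable_div_betaPW hβm hβp hcont α l r).const_mul _) fun s _ => ?_
    have hb := betaPW_pos hβm hβp α s
    rw [mul_div_assoc', le_div_iff₀ hb, mul_comm]
    exact mul_le_mul_of_nonneg_right (betaPW_le_max _ _ _ _) (sq_nonneg _)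
  have h3 : ∫ s in l..r, B.eval s ^ 2 / betaPW βm βp α s ≤ δ ^ 2 * ((r - l) / min βm βp) := by
    have hq := hQ (B ^ 2) (Polynomial.natDegree_pow_le.trans (by omega))
    simp only [Polynomial.eval_pow] at hq
    rw [← hq]
    calc ∑ j ∈ Finset.Icc 1 p, A j * B.eval (g j) ^ 2
        ≤ ∑ j ∈ Finset.Icc 1 p, δ ^ 2 * A j := by
          refine Finset.sum_le_sum fun j hj => ?_
          rw [mul_comm, ← sq_abs]
          have := hA j hj
          have := hBg j hj
          gcongr
      _ ≤ δ ^ 2 * ((r - l) / min βm βp) := by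
          rw [← Finset.mul_sum]
          gcongr
          exact sum_weights_le hβm hβp hlr.le hQ
  have h4 : B.eval t ^ 2 * (r - l) ≤ C * max βm βp / min βm βp * δ ^ 2 * (r - l) := by
    calc B.eval t ^ 2 * (r - l)
        ≤ C * (max βm βp * (δ ^ 2 * ((r - l) / min βm βp))) := 
          h1.trans (by gcongr; exact h2.trans (by gcongr))
      _ = _ := by ring
  have h5 := le_of_mul_le_mul_right h4 hh
  refine abs_le_of_sq_le_sq ?_ (by positivity)
  rwa [mul_pow, Real.sq_sqrt (by positivity)]

/-- Fundamental theorem of calculus for functions with bounded derivative off a countable set. -/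
lemma integral_deriv_off_countable {F : ℝ → ℝ} {l r M : ℝ} {s : Set ℝ} (hlr : l ≤ r)
    (hs : s.Countable) (hF : ContinuousOn F (Icc l r))
    (hd : ∀ t ∈ Ioo l r, t ∉ s → DifferentiableAt ℝ F t)
    (hM : ∀ t ∈ Ioo l r, t ∉ s → |deriv F t| ≤ M) :
    IntervalIntegrable (deriv F) MeasureTheory.volume l r ∧
      ∫ t in l..r, deriv F t = F r - F l := by
  have hint : IntervalIntegrable (deriv F) MeasureTheory.volume l r := by
    rw [intervalIntegrable_iff_integrableOn_Ioo_of_le hlr]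
    refine MeasureTheory.Measure.integrableOn_of_bounded (M := M) (by simp)
      (measurable_deriv F).aestronglyMeasurable ?_
    filter_upwards [MeasureTheory.ae_restrict_mem measurableSet_Ioo,
      MeasureTheory.ae_restrict_of_ae (hs.ae_notMem MeasureTheory.volume)] with t ht hts
    exact hM t ht hts
  exact ⟨hint, MeasureTheory.integral_eq_of_hasDerivAt_off_countable_of_le F (deriv F) hlr hs hF
    (fun t ht => (hd t ht.1 ht.2).hasDerivAt) hint⟩

/-- A perturbed solution of the first-order integral form of the boundary value problem has a
flux constant controlled by the perturbation. -/
lemma flux_constant_le {βm βp γ c r : ℝ} (hβm : 0 < βm) (hβp : 0 < βp) (hc : 0 < c) {a b α K : ℝ}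
    (hab : a < b) {e ρ S η : ℝ → ℝ} (he : Continuous e) (heb : e b = 0)
    (hSd : ∀ t, HasDerivAt S (e t) t) (hSa : S a = 0) (hηc : Continuous η)
    (hηd : ∀ t, t ≠ α → HasDerivAt η ((K + γ * e t + c * S t) / betaPW βm βp α t) t)
    (hηa : η a = 0) (hρ : ∀ t, ρ t = e t - η t) (hr : ∀ t ∈ Icc a b, |ρ t| ≤ r) :
    K ≤ (|γ| + c * (b - a) + max βm βp / (b - a)
      * Real.exp (|γ| * (b - a) / min βm βp) ^ 2) * r := by
  have hd : 0 < b - a := sub_pos.2 hab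
  have hr0 : 0 ≤ r := (abs_nonneg _).trans (hr a (left_mem_Icc.2 hab.le))
  have hlo := lt_min hβm hβp
  have hhi : 0 < max βm βp := lt_max_of_lt_left hβm
  have hSc : Continuous S := continuous_iff_continuousAt.2 fun t => (hSd t).continuousAt
  have hρc : Continuous ρ := by
    rw [show ρ = fun t => e t - η t from funext hρ]
    exact he.sub hηc
  set m := Real.exp (|γ| * (b - a) / min βm βp) with hm
  have hm0 : 0 < m := Real.exp_pos _
  by_contra! hK
  rw [add_mul] at hK
  set κ₀ := K - (|γ| + c * (b - a)) * r with hκ₀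
  have hκ₀pos : 0 < κ₀ := by
    have : 0 ≤ max βm βp / (b - a) * m ^ 2 * r := by positivity
    rw [hκ₀]
    linarith
  set θ : ℝ → ℝ := fun x => ∫ s in a..x, 1 / betaPW βm βp α s with hθ
  have hθc : Continuous θ := continuous_integral_div_betaPW hβm hβp continuous_const α a
  have hθd : ∀ t, t ≠ α → HasDerivAt θ (1 / betaPW βm βp α t) t := fun t ht =>
    hasDerivAt_integral_div_betaPW hβm hβp continuous_const a ht
  have hθ0 : ∀ t ∈ Icc a b, 0 ≤ θ t := fun t ht =>
    intervalIntegral.integral_nonneg ht.1 fun s _ =>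
      one_div_nonneg.2 (betaPW_pos hβm hβp α s).le
  have hθ1 : ∀ t ∈ Icc a b, θ t ≤ (b - a) / min βm βp := fun t ht =>
    (integral_div_betaPW_le hβm hβp ht.1).trans (by have := ht.2; gcongr)
  have habs : ∀ t ∈ Icc a b, |γ * θ t| ≤ |γ| * (b - a) / min βm βp := by
    intro t ht
    rw [abs_mul, abs_of_nonneg (hθ0 t ht), mul_div_assoc]
    exact mul_le_mul_of_nonneg_left (hθ1 t ht) (abs_nonneg _)
  set μ : ℝ → ℝ := fun t => Real.exp (-(γ * θ t)) with hμ
  have hμlo : ∀ t ∈ Icc a b, m⁻¹ ≤ μ t := by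
    intro t ht
    rw [hm, ← Real.exp_neg, Real.exp_le_exp]
    linarith [(abs_le.1 (habs t ht)).2]
  have hμhi : ∀ t ∈ Icc a b, μ t ≤ m := by
    intro t ht
    rw [hm, Real.exp_le_exp]
    linarith [(abs_le.1 (habs t ht)).1]
  have hμc : Continuous μ := by fun_prop
  set φ : ℝ → ℝ := fun t => K + γ * ρ t + c * S t with hφ
  have hφc : Continuous φ := by fun_prop
  have hμη : Continuous fun x => μ x * η x := hμc.mul hηc
  have hd' : ∀ t, t ≠ α →
      HasDerivAt (fun x => μ x * η x) (μ t * φ t / betaPW βm βp α t) t := by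
    intro t ht
    refine ((((hθd t ht).const_mul γ).neg.exp).mul (hηd t ht)).congr_deriv ?_
    have hb := (betaPW_pos hβm hβp α t).ne'
    simp only [hφ, hμ, hρ, Pi.neg_apply]
    field_simp
    ring
  have hφlow : ∀ z ∈ Icc a b, (∀ t ∈ Ioo a z, 0 ≤ φ t) → κ₀ ≤ φ z := by
    intro z hz hpos
    have hη0 : ∀ t ∈ Ioo a z, 0 ≤ η t := by
      intro t ht
      have h := mul_sub_le_of_le_deriv_off_point (α := α) (m := 0) ht.1.le
        hμη.continuousOn (fun s _ hs => hd' s hs) (fun s hs _ =>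
          div_nonneg (mul_nonneg (Real.exp_pos _).le (hpos s ⟨hs.1, hs.2.trans ht.2⟩))
            (betaPW_pos hβm hβp α s).le)
      simp only [hηa, mul_zero, zero_mul, sub_zero] at h
      exact nonneg_of_mul_nonneg_right h (Real.exp_pos _)
    have hS := mul_sub_le_of_le_deriv_off_point (α := α) (m := -r) hz.1
      hSc.continuousOn (fun s _ _ => hSd s) (fun s hs _ => by
        have h1 := hη0 s hs
        have h2 := (abs_le.1 (hr s ⟨hs.1.le, hs.2.le.trans hz.2⟩)).1
        rw [hρ] at h2
        linarith)
    rw [hSa, sub_zero] at hS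
    have h1 : -(|γ| * r) ≤ γ * ρ z := by
      have : |γ * ρ z| ≤ |γ| * r := by
        rw [abs_mul]
        exact mul_le_mul_of_nonneg_left (hr z hz) (abs_nonneg _)
      exact (abs_le.1 this).1
    have h2 : -(r * (b - a)) ≤ S z := by
      have := mul_le_mul_of_nonneg_left (sub_le_sub_right hz.2 a) hr0
      linarith
    have h3 := mul_le_mul_of_nonneg_left h2 hc.le
    simp only [hφ, hκ₀]
    linarith
  have hφpos : ∀ z ∈ Icc a b, 0 < φ z := by
    by_contra! hex
    obtain ⟨z₁, hz₁, hz₁φ⟩ := hex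
    have hcpt : IsCompact (Icc a b ∩ {t | φ t ≤ 0}) :=
      isCompact_Icc.inter_right (isClosed_le hφc continuous_const)
    obtain ⟨z, hz, hleast⟩ := hcpt.exists_isLeast ⟨z₁, hz₁, hz₁φ⟩
    have h1 := hφlow z hz.1 fun t ht => by
      by_contra! hneg
      exact absurd (hleast ⟨⟨ht.1.le, ht.2.le.trans hz.1.2⟩, hneg.le⟩) ht.2.not_ge
    have h2 : φ z ≤ 0 := hz.2
    linarith
  have hfin := mul_sub_le_of_le_deriv_off_point (α := α) (m := m⁻¹ * κ₀ / max βm βp) hab.le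
    hμη.continuousOn (fun s _ hs => hd' s hs) (fun s hs _ => by
      have hs' := Ioo_subset_Icc_self hs
      have h1 := hφlow s hs' fun t ht => (hφpos t ⟨ht.1.le, ht.2.le.trans hs.2.le⟩).le
      have h2 := hμlo s hs'
      have h3 := betaPW_pos hβm hβp α s
      have h4 := betaPW_le_max βm βp α s
      have h5 : 0 < μ s := Real.exp_pos _
      have h6 := hφpos s hs'
      gcongr)
  have hbm := right_mem_Icc.2 hab.le
  have hηb : μ b * η b ≤ m * r := by
    have h1 := (abs_le.1 (hr b hbm)).1
    rw [hρ, heb] at h1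
    calc μ b * η b ≤ μ b * r := mul_le_mul_of_nonneg_left (by linarith) (Real.exp_pos _).le
      _ ≤ m * r := mul_le_mul_of_nonneg_right (hμhi b hbm) hr0
  simp only [hηa, mul_zero, sub_zero] at hfin
  have h7 : κ₀ ≤ max βm βp / (b - a) * m ^ 2 * r := by
    have h8 := hfin.trans hηb
    calc κ₀ = m⁻¹ * κ₀ / max βm βp * (b - a) * (m * (max βm βp / (b - a))) := by field_simp
      _ ≤ m * r * (m * (max βm βp / (b - a))) := by gcongr
      _ = _ := by ring
  linarith

/-- Stability of the two-point boundary value problem written as a first-order integral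
equation, uniformly in the position of the interface. -/
lemma exists_stability_constant {βm βp c d : ℝ} (hβm : 0 < βm) (hβp : 0 < βp) (γ : ℝ)
    (hc : 0 < c) (hd : 0 < d) : ∃ Cs : ℝ, 0 < Cs ∧
    ∀ (a b α K r : ℝ) (e : ℝ → ℝ), b - a = d → Continuous e → e b = 0 →
      (∀ t ∈ Icc a b, |e t - ∫ x in a..t, (K + γ * e x + c * ∫ y in a..x, e y)
        / betaPW βm βp α x| ≤ r) →
      |K| ≤ Cs * r ∧ ∀ t ∈ Icc a b, |e t| ≤ Cs * r := by
  have hlo := lt_min hβm hβp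
  have hhi : 0 < max βm βp := lt_max_of_lt_left hβm
  set CK := |γ| + c * d + max βm βp / d * Real.exp (|γ| * d / min βm βp) ^ 2 with hCK
  set lam := 1 + 2 * (|γ| + c) / min βm βp with hlam
  have hCK0 : 0 < CK := by positivity
  have hlam1 : 1 ≤ lam := le_add_of_nonneg_right (by positivity)
  have hlam0 : 0 < lam := by positivity
  set CE := 2 * (1 + CK * d / min βm βp) * Real.exp (lam * d) with hCE
  have hCE0 : 0 < CE := by positivity
  refine ⟨CK + CE, by positivity, ?_⟩
  intro a b α K r e hbd he heb hr
  have hab : a < b := by linarith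
  have hr0 : 0 ≤ r := (abs_nonneg _).trans (hr a (left_mem_Icc.2 hab.le))
  set S : ℝ → ℝ := fun x => ∫ y in a..x, e y with hS
  have hSd : ∀ t, HasDerivAt S (e t) t := fun t => (he.integral_hasStrictDerivAt a t).hasDerivAt
  have hSc : Continuous S := continuous_iff_continuousAt.2 fun t => (hSd t).continuousAt
  have hSa : S a = 0 := intervalIntegral.integral_same
  set w : ℝ → ℝ := fun x => K + γ * e x + c * S x with hw
  have hwc : Continuous w := by fun_prop
  set η : ℝ → ℝ := fun t => ∫ x in a..t, w x / betaPW βm βp α x with hη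
  have hηc : Continuous η := continuous_integral_div_betaPW hβm hβp hwc α a
  have hηd : ∀ t, t ≠ α → HasDerivAt η (w t / betaPW βm βp α t) t := fun t ht =>
    hasDerivAt_integral_div_betaPW hβm hβp hwc a ht
  have hηa : η a = 0 := intervalIntegral.integral_same
  have hK : |K| ≤ CK * r := by
    rw [hCK, ← hbd]
    refine abs_le'.2 ⟨flux_constant_le hβm hβp hc hab he heb hSd hSa hηc hηd hηa
      (fun t => rfl) hr, ?_⟩
    refine flux_constant_le (α := α) (K := -K) (e := fun t => -e t) (S := fun t => -S t)
      (η := fun t => -η t) (ρ := fun t => -(e t - η t)) hβm hβp hc hab he.neg (by simp [heb])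
      (fun t => (hSd t).neg) (by simp [hSa]) hηc.neg (fun t ht => ?_)
      (by simp [hηa]) (fun t => by ring) (fun t ht => by simpa only [abs_neg] using hr t ht)
    refine (hηd t ht).neg.congr_deriv ?_
    simp only [hw]
    ring
  refine ⟨hK.trans (by nlinarith), ?_⟩
  obtain ⟨t₀, ht₀, hmax⟩ := isCompact_Icc.exists_isMaxOn (nonempty_Icc.2 hab.le)
    (f := fun t => |e t| * Real.exp (-(lam * (t - a)))) (by fun_prop)
  set M := |e t₀| * Real.exp (-(lam * (t₀ - a))) with hM
  have hM0 : 0 ≤ M := by positivity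
  have hEb : ∀ t ∈ Icc a b, |e t| ≤ M * Real.exp (lam * (t - a)) := by
    intro t ht
    have h : |e t| * Real.exp (-(lam * (t - a))) ≤ M := hmax ht
    rwa [Real.exp_neg, ← div_eq_mul_inv, div_le_iff₀ (Real.exp_pos _)] at h
  have hexpd : ∀ t : ℝ, HasDerivAt (fun x => Real.exp (lam * (x - a)))
      (lam * Real.exp (lam * (t - a))) t := by
    intro t
    have h := (((hasDerivAt_id t).sub_const a).const_mul lam).exp
    simpa [mul_comm] using h
  have cmp : ∀ (F F' : ℝ → ℝ) (L B : ℝ), 0 ≤ B → Continuous F → F a = 0 →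
      (∀ t, t ≠ α → HasDerivAt F (F' t) t) →
      (∀ t ∈ Icc a b, F' t ≤ L + B * Real.exp (lam * (t - a))) → ∀ t ∈ Icc a b,
      F t ≤ L * (t - a) + B / lam * Real.exp (lam * (t - a)) := by
    intro F F' L B hB hF hFa hFd hFB t ht
    have h := mul_sub_le_of_le_deriv_off_point (α := α) (m := 0) ht.1
      (F := fun x => L * (x - a) + B / lam * Real.exp (lam * (x - a)) - F x)
      (by fun_prop)
      (fun s _ hs => ((((hasDerivAt_id s).sub_const a).const_mul L).add
        ((hexpd s).const_mul (B / lam))).sub (hFd s hs))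
      (fun s hs _ => by
        have h1 := hFB s ⟨hs.1.le, hs.2.le.trans ht.2⟩
        have h2 : B / lam * (lam * Real.exp (lam * (s - a))) = B * Real.exp (lam * (s - a)) := by
          field_simp
        rw [h2]
        linarith)
    simp only [hFa, sub_self, mul_zero, Real.exp_zero, zero_mul, zero_add, mul_one, sub_zero] at h
    have : 0 ≤ B / lam := by positivity
    linarith
  have cmpabs : ∀ (F F' : ℝ → ℝ) (L B : ℝ), 0 ≤ B → Continuous F → F a = 0 →
      (∀ t, t ≠ α → HasDerivAt F (F' t) t) →
      (∀ t ∈ Icc a b, |F' t| ≤ L + B * Real.exp (lam * (t - a))) → ∀ t ∈ Icc a b,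
      |F t| ≤ L * (t - a) + B / lam * Real.exp (lam * (t - a)) := by
    intro F F' L B hB hF hFa hFd hFB t ht
    refine abs_le'.2 ⟨cmp F F' L B hB hF hFa hFd (fun s hs => (le_abs_self _).trans (hFB s hs))
      t ht, ?_⟩
    exact cmp (fun x => -F x) (fun x => -F' x) L B hB hF.neg (by simp [hFa])
      (fun s hs => (hFd s hs).neg) (fun s hs => (neg_le_abs _).trans (hFB s hs)) t ht
  have hSb : ∀ t ∈ Icc a b, |S t| ≤ M * Real.exp (lam * (t - a)) := by
    intro t ht
    have h := cmpabs S e 0 M hM0 hSc hSa (fun s _ => hSd s)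
      (fun s hs => by simpa using hEb s hs) t ht
    rw [zero_mul, zero_add] at h
    refine h.trans ?_
    gcongr
    exact div_le_self hM0 hlam1
  have hwb : ∀ t ∈ Icc a b, |w t / betaPW βm βp α t| ≤ |K| / min βm βp
      + (|γ| + c) * M / min βm βp * Real.exp (lam * (t - a)) := by
    intro t ht
    have hb := betaPW_pos hβm hβp α t
    have h1 : |w t| ≤ |K| + (|γ| + c) * M * Real.exp (lam * (t - a)) := by
      calc |w t| ≤ |K| + |γ * e t| + |c * S t| := abs_add_three _ _ _
        _ ≤ |K| + |γ| * (M * Real.exp (lam * (t - a)))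
            + c * (M * Real.exp (lam * (t - a))) := by
          rw [abs_mul, abs_mul, abs_of_pos hc]
          have := hEb t ht
          have := hSb t ht
          gcongr
        _ = _ := by ring
    rw [abs_div, abs_of_pos hb]
    calc |w t| / betaPW βm βp α t ≤ (|K| + (|γ| + c) * M * Real.exp (lam * (t - a)))
          / min βm βp := by
          have := min_le_betaPW βm βp α t
          gcongr
      _ = _ := by ring
  have hηb := cmpabs η _ _ _ (by positivity) hηc hηa hηd hwb t₀ ht₀
  have hsmall : (|γ| + c) * M / min βm βp / lam ≤ M / 2 := by
    have h1 : 2 * (|γ| + c) ≤ lam * min βm βp := by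
      rw [hlam, add_mul, div_mul_cancel₀ _ hlo.ne']
      linarith
    rw [div_div, div_le_div_iff₀ (by positivity) two_pos]
    nlinarith
  have het₀ : |e t₀| = M * Real.exp (lam * (t₀ - a)) := by
    rw [hM, mul_assoc, ← Real.exp_add]
    simp
  have h1 : |e t₀| ≤ r + |η t₀| := by
    have h2 := hr t₀ ht₀
    have h3 := abs_sub_abs_le_abs_sub (e t₀) (η t₀)
    linarith
  have h4 : |K| / min βm βp * (t₀ - a) ≤ CK * r / min βm βp * d := by
    have := ht₀.2
    have : t₀ - a ≤ d := by linarith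
    have := sub_nonneg.2 ht₀.1
    gcongr
  have hexp1 : 1 ≤ Real.exp (lam * (t₀ - a)) :=
    Real.one_le_exp (mul_nonneg hlam0.le (sub_nonneg.2 ht₀.1))
  have h5 : (|γ| + c) * M / min βm βp / lam * Real.exp (lam * (t₀ - a))
      ≤ M / 2 * Real.exp (lam * (t₀ - a)) := by gcongr
  have hMle : M ≤ 2 * (1 + CK * d / min βm βp) * r := by
    have h6 : M ≤ M * Real.exp (lam * (t₀ - a)) := le_mul_of_one_le_right hM0 hexp1
    have h7 : CK * r / min βm βp * d = CK * d / min βm βp * r := by ring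
    linarith
  intro t ht
  have h8 : Real.exp (lam * (t - a)) ≤ Real.exp (lam * d) := by
    have := ht.2
    gcongr
    linarith
  calc |e t| ≤ M * Real.exp (lam * (t - a)) := hEb t ht
    _ ≤ 2 * (1 + CK * d / min βm βp) * r * Real.exp (lam * d) := by gcongr
    _ = CE * r := by ring
    _ ≤ (CK + CE) * r := by nlinarith

/-- If the flux residual vanishes at the Gauss points and the exact flux is close to a polynomial
of degree `≤ p - 1`, then the residual is small on the whole element. -/
lemma abs_residual_le {p : ℕ} {l r α δ₁ δ₂ Λ K : ℝ} {g v Z : ℝ → ℝ} {G : ℕ → ℝ}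
    {s Q : Polynomial ℝ}
    (hΛ : ∀ (B : Polynomial ℝ) (δ : ℝ), B.natDegree ≤ p - 1 → 0 ≤ δ →
      (∀ j ∈ Finset.Icc 1 p, |B.eval (G j)| ≤ δ) → ∀ t ∈ Icc l r, |B.eval t| ≤ Λ * δ)
    (hδ₁ : 0 ≤ δ₁) (hδ₂ : 0 ≤ δ₂) (hs : s.natDegree ≤ p - 1) (hQ : Q.natDegree ≤ p - 1)
    (hv : ∀ t ∈ Ioo l r, t ≠ α → |v t - Q.eval t| ≤ δ₁)
    (hZ : ∀ t ∈ Ioo l r, t ≠ α → |Z t| ≤ δ₂)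
    (hg : ∀ t ∈ Ioo l r, t ≠ α → g t = s.eval t)
    (hGmem : ∀ j ∈ Finset.Icc 1 p, G j ∈ Ioo l r ∧ G j ≠ α)
    (hG : ∀ j ∈ Finset.Icc 1 p, v (G j) - g (G j) = K + Z (G j)) :
    ∀ t ∈ Ioo l r, t ≠ α → |v t - g t - (K + Z t)| ≤ (1 + Λ) * (δ₁ + δ₂) := by
  intro t ht hne
  have hB := hΛ (Q - s - Polynomial.C K) (δ₁ + δ₂)
    ((Polynomial.natDegree_sub_C).trans_le (Polynomial.natDegree_sub_le_of_le hQ hs |>.trans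
      (max_self _).le)) (by positivity) (fun j hj => by
      obtain ⟨hm, hn⟩ := hGmem j hj
      have h1 := hG j hj
      rw [hg _ hm hn] at h1
      have h2 : (Q - s - Polynomial.C K).eval (G j)
          = Z (G j) - (v (G j) - Q.eval (G j)) := by
        simp only [Polynomial.eval_sub, Polynomial.eval_C]
        linarith
      rw [h2]
      have := abs_sub (Z (G j)) (v (G j) - Q.eval (G j))
      linarith [hv _ hm hn, hZ _ hm hn]) t (Ioo_subset_Icc_self ht)
  have h3 : v t - g t - (K + Z t)
      = (v t - Q.eval t) + (Q - s - Polynomial.C K).eval t + -Z t := by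
    rw [hg t ht hne]
    simp only [Polynomial.eval_sub, Polynomial.eval_C]
    ring
  rw [h3]
  have h4 := abs_add_three (v t - Q.eval t) ((Q - s - Polynomial.C K).eval t) (-Z t)
  rw [abs_neg] at h4
  linarith [hv t ht hne, hZ t ht hne]

/-- Accuracy of the Gauss quadrature for a residual that vanishes at the Gauss points and is close
to a polynomial of degree `≤ 2 * p - 1`. -/
lemma abs_sub_le_of_residual_near_polynomial {βm βp : ℝ} (hβm : 0 < βm) (hβp : 0 < βp) {p : ℕ}
    {α l r δ : ℝ} {G A : ℕ → ℝ} {ρ ρ' : ℝ → ℝ} {F : Polynomial ℝ} (hlr : l ≤ r)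
    (hA : ∀ j ∈ Finset.Icc 1 p, 0 < A j)
    (hquad : ∀ F : Polynomial ℝ, F.natDegree ≤ 2 * p - 1 →
      ∑ j ∈ Finset.Icc 1 p, A j * F.eval (G j) = ∫ t in l..r, F.eval t / betaPW βm βp α t)
    (hF : F.natDegree ≤ 2 * p - 1) (hδ : 0 ≤ δ) (hρ : Continuous ρ)
    (hρ' : ∀ t ∈ Ioo l r, t ≠ α → HasDerivAt ρ (ρ' t) t)
    (hres : ∀ t ∈ Ioo l r, t ≠ α → |betaPW βm βp α t * ρ' t - F.eval t| ≤ δ)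
    (hFG : ∀ j ∈ Finset.Icc 1 p, |F.eval (G j)| ≤ δ) :
    |ρ r - ρ l| ≤ 2 * δ / min βm βp * (r - l) := by
  have hlo := lt_min hβm hβp
  have hFc : Continuous fun t => F.eval t := by fun_prop
  have h1 := abs_sub_le_of_abs_deriv_le_off_point (α := α) (M := δ / min βm βp) hlr
    (F := fun x => ρ x - ∫ t in l..x, F.eval t / betaPW βm βp α t)
    (hρ.sub (continuous_integral_div_betaPW hβm hβp hFc α l)).continuousOn
    (fun t ht hne => (hρ' t ht hne).sub (hasDerivAt_integral_div_betaPW hβm hβp hFc l hne))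
    (fun t ht hne => by
      have hb := betaPW_pos hβm hβp α t
      have h2 : ρ' t - F.eval t / betaPW βm βp α t
          = (betaPW βm βp α t * ρ' t - F.eval t) / betaPW βm βp α t := by field_simp
      rw [h2, abs_div, abs_of_pos hb]
      exact div_le_div₀ hδ (hres t ht hne) hlo (min_le_betaPW _ _ _ _))
  simp only [intervalIntegral.integral_same, sub_zero] at h1
  have h3 : |∫ t in l..r, F.eval t / betaPW βm βp α t| ≤ δ * ((r - l) / min βm βp) := by
    rw [← hquad F hF]
    calc |∑ j ∈ Finset.Icc 1 p, A j * F.eval (G j)|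
        ≤ ∑ j ∈ Finset.Icc 1 p, |A j * F.eval (G j)| := Finset.abs_sum_le_sum_abs _ _
      _ ≤ ∑ j ∈ Finset.Icc 1 p, δ * A j := by
          refine Finset.sum_le_sum fun j hj => ?_
          rw [abs_mul, abs_of_pos (hA j hj), mul_comm]
          exact mul_le_mul_of_nonneg_right (hFG j hj) (hA j hj).le
      _ ≤ δ * ((r - l) / min βm βp) := by
          rw [← Finset.mul_sum]
          exact mul_le_mul_of_nonneg_left (sum_weights_le hβm hβp hlr hquad) hδ
  have h4 : ρ r - ρ l = (ρ r - (∫ t in l..r, F.eval t / betaPW βm βp α t) - ρ l)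
      + ∫ t in l..r, F.eval t / betaPW βm βp α t := by ring
  rw [h4]
  refine (abs_add_le _ _).trans ((add_le_add h1 h3).trans_eq ?_)
  ring

/-- The function `u` is smooth of order `m` on `[L, R]`, with derivatives bounded by `W`. -/
def SmoothPiece (m : ℕ) (L R W : ℝ) (u : ℝ → ℝ) : Prop :=
  ContDiffOn ℝ (m : ℕ∞) u (Icc L R) ∧
    ∀ j ≤ m, ∀ t ∈ Icc L R, |iteratedDerivWithin j u (Icc L R) t| ≤ W

namespace SmoothPiece

variable {m : ℕ} {L R W : ℝ} {u : ℝ → ℝ}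

lemma nonneg (h : SmoothPiece m L R W u) (hLR : L < R) : 0 ≤ W :=
  (abs_nonneg _).trans (h.2 0 m.zero_le L (left_mem_Icc.2 hLR.le))

lemma deriv_eq {t : ℝ} (ht : t ∈ Ioo L R) : deriv u t = derivWithin u (Icc L R) t :=
  (derivWithin_of_mem_nhds (Icc_mem_nhds ht.1 ht.2)).symm

lemma differentiableAt (h : SmoothPiece m L R W u) (hm : 1 ≤ m) {t : ℝ} (ht : t ∈ Ioo L R) :
    DifferentiableAt ℝ u t :=
  (h.1.differentiableOn (by exact_mod_cast (Nat.one_le_iff_ne_zero.1 hm)) t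
    (Ioo_subset_Icc_self ht)).differentiableAt (Icc_mem_nhds ht.1 ht.2)

lemma abs_sub_taylorPoly_le (h : SmoothPiece m L R W u) (hLR : L < R) {n : ℕ} (hn : n + 1 ≤ m)
    {x₀ x : ℝ} (hx₀ : x₀ ∈ Icc L R) (hx : x ∈ Icc L R) :
    |u x - (taylorPoly (fun i => iteratedDerivWithin i u (Icc L R) x₀) x₀ n).eval x|
      ≤ W * |x - x₀| ^ (n + 1) :=
  abs_sub_eval_taylorPoly_le hLR hx₀ n u (h.1.of_le (by exact_mod_cast hn)) (h.2 _ hn) x hx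

lemma abs_deriv_sub_taylorPoly_le (h : SmoothPiece m L R W u) (hLR : L < R) {n : ℕ}
    (hn : n + 2 ≤ m) {x₀ x : ℝ} (hx₀ : x₀ ∈ Icc L R) (hx : x ∈ Ioo L R) :
    |deriv u x - (taylorPoly (fun i => iteratedDerivWithin (i + 1) u (Icc L R) x₀) x₀ n).eval x|
      ≤ W * |x - x₀| ^ (n + 1) := by
  have := abs_sub_eval_taylorPoly_le (M := W) hLR hx₀ n (derivWithin u (Icc L R))
    (h.1.derivWithin (uniqueDiffOn_Icc hLR) (by exact_mod_cast hn))
    (by simpa only [← iteratedDerivWithin_succ'] using h.2 _ hn) x (Ioo_subset_Icc_self hx)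
  simp only [← iteratedDerivWithin_succ'] at this
  rwa [deriv_eq hx]

end SmoothPiece

lemma eval_taylorPoly_const_mul (k : ℝ) (D : ℕ → ℝ) (x₀ : ℝ) (n : ℕ) (x : ℝ) :
    (taylorPoly (fun i => k * D i) x₀ n).eval x = k * (taylorPoly D x₀ n).eval x := by
  simp only [taylorPoly, Polynomial.eval_finsetSum, Finset.mul_sum, Polynomial.eval_mul,
    Polynomial.eval_C]
  exact Finset.sum_congr rfl fun i _ => by ring

lemma taylorPoly_congr {D D' : ℕ → ℝ} {n : ℕ} (h : ∀ i ≤ n, D i = D' i) (x₀ : ℝ) :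
    taylorPoly D x₀ n = taylorPoly D' x₀ n :=
  Finset.sum_congr rfl fun i hi => by rw [h i (Nat.lt_succ_iff.1 (Finset.mem_range.1 hi))]

/-- Across the interface the flux of a function with matching flux derivatives is approximated by
a single Taylor polynomial. -/
lemma exists_interface_polynomial {βm βp : ℝ} (hβm : 0 < βm) (hβp : 0 < βp) {m n : ℕ}
    {a b α l r W : ℝ} {u : ℝ → ℝ} (hα : α ∈ Ioo a b) (hl : a ≤ l) (hr : r ≤ b)
    (hlα : l ≤ α) (hαr : α ≤ r)
    (hm : SmoothPiece m a α W u) (hp : SmoothPiece m α b W u) (hn : n + 2 ≤ m)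
    (hjump : ∀ j, 1 ≤ j → j ≤ m → βm * iteratedDerivWithin j u (Icc a α) α
      = βp * iteratedDerivWithin j u (Icc α b) α) :
    ∃ Q : Polynomial ℝ, Q.natDegree ≤ n ∧ ∀ t ∈ Ioo l r, t ≠ α →
      |betaPW βm βp α t * deriv u t - Q.eval t| ≤ max βm βp * W * (r - l) ^ (n + 1) := by
  have hW := hm.nonneg hα.1
  refine ⟨taylorPoly (fun i => βp * iteratedDerivWithin (i + 1) u (Icc α b) α) α n,
    natDegree_taylorPoly_le _ _ _, fun t ht hne => ?_⟩
  have hdist : |t - α| ≤ r - l := by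
    rw [abs_le]
    constructor <;> linarith [ht.1, ht.2]
  have fin : ∀ k D, 0 < k → k ≤ max βm βp → |deriv u t - D| ≤ W * |t - α| ^ (n + 1) →
      |k * deriv u t - k * D| ≤ max βm βp * W * (r - l) ^ (n + 1) := by
    intro k D hk hkm hD
    rw [← mul_sub, abs_mul, abs_of_pos hk, mul_assoc]
    have h0 : W * |t - α| ^ (n + 1) ≤ W * (r - l) ^ (n + 1) := by gcongr
    exact mul_le_mul hkm (hD.trans h0) (abs_nonneg _) (hk.le.trans hkm)
  rcases hne.lt_or_gt with h | h
  · rw [betaPW_of_lt h, taylorPoly_congr (fun i hi => (hjump (i + 1) (by omega)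
      (by omega)).symm), eval_taylorPoly_const_mul]
    exact fin _ _ hβm (le_max_left _ _) (hm.abs_deriv_sub_taylorPoly_le hα.1 hn
      (right_mem_Icc.2 hα.1.le) ⟨hl.trans_lt ht.1, h⟩)
  · rw [betaPW_of_gt h, eval_taylorPoly_const_mul]
    exact fin _ _ hβp (le_max_right _ _) (hp.abs_deriv_sub_taylorPoly_le hα.2 hn
      (left_mem_Icc.2 hα.2.le) ⟨h, ht.2.trans_le hr⟩)

/-- The flux of an immersed piecewise polynomial is a single polynomial. -/
lemma interface_flux_eq {βm βp α : ℝ} {p : ℕ} (hp : 1 ≤ p) {qm qp : Polynomial ℝ}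
    (hqm : qm.natDegree ≤ p) (hqp : qp.natDegree ≤ p)
    (hjump : ∀ j, 1 ≤ j → j ≤ p → βm * ((⇑Polynomial.derivative)^[j] qm).eval α
      = βp * ((⇑Polynomial.derivative)^[j] qp).eval α) :
    Polynomial.C βm * Polynomial.derivative qm = Polynomial.C βp * Polynomial.derivative qp := by
  set D := Polynomial.C βm * qm - Polynomial.C βp * qp with hD
  suffices h : Polynomial.derivative D = 0 by
    rw [hD, Polynomial.derivative_sub, Polynomial.derivative_C_mul,
      Polynomial.derivative_C_mul] at h
    exact sub_eq_zero.1 h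
  by_contra hne
  have hdeg : (Polynomial.derivative D).natDegree ≤ p - 1 := by
    refine (Polynomial.natDegree_derivative_le D).trans (Nat.sub_le_sub_right ?_ 1)
    exact (Polynomial.natDegree_sub_le_of_le ((Polynomial.natDegree_C_mul_le _ _).trans hqm)
      ((Polynomial.natDegree_C_mul_le _ _).trans hqp)).trans (max_self _).le
  have hroot := (Polynomial.lt_rootMultiplicity_iff_isRoot_iterate_derivative (t := α)
    (n := p - 1) hne).2 (fun j hj => by
      rw [← Function.iterate_succ_apply, hD, Polynomial.IsRoot,
        Polynomial.iterate_derivative_sub, Polynomial.iterate_derivative_C_mul,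
        Polynomial.iterate_derivative_C_mul]
      simp only [Polynomial.eval_sub, Polynomial.eval_mul, Polynomial.eval_C]
      exact sub_eq_zero.2 (hjump (j + 1) (by omega) (by omega)))
  have h2 : Polynomial.rootMultiplicity α (Polynomial.derivative D)
      ≤ (Polynomial.derivative D).natDegree := by
    rw [← Polynomial.count_roots]
    exact (Multiset.count_le_card _ _).trans (Polynomial.card_roots' _)
  omega

/-- Increment of the consistency error over an element on which the coefficient is constant. -/
lemma abs_sub_le_of_regular_element {βm βp γ c : ℝ} (hβm : 0 < βm) (hβp : 0 < βp) (hc : 0 < c)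
    {p m : ℕ} (hp : 2 ≤ p) (hpm : p + 2 ≤ m) {L R W α l r K hm b₀ : ℝ} {G A : ℕ → ℝ}
    {u e S ρ : ℝ → ℝ} {q : Polynomial ℝ} (hu : SmoothPiece m L R W u) (hlr : l < r)
    (hL : L ≤ l) (hR : r ≤ R) (hb₀ : ∀ t ∈ Icc l r, betaPW βm βp α t = b₀)
    (hh : r - l ≤ hm) (hm1 : hm ≤ 1)
    (hA : ∀ j ∈ Finset.Icc 1 p, 0 < A j)
    (hquad : ∀ F : Polynomial ℝ, F.natDegree ≤ 2 * p - 1 →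
      ∑ j ∈ Finset.Icc 1 p, A j * F.eval (G j) = ∫ t in l..r, F.eval t / betaPW βm βp α t)
    (hGmem : ∀ j ∈ Finset.Icc 1 p, G j ∈ Ioo l r)
    (hq : q.natDegree ≤ p) (he : ∀ t ∈ Icc l r, e t = u t - q.eval t)
    (hS : ∀ t, HasDerivAt S (e t) t) (hρ : Continuous ρ)
    (hρ' : ∀ t ∈ Ioo l r, t ≠ α → HasDerivAt ρ (deriv u t - (Polynomial.derivative q).eval t
      - (K + γ * e t + c * S t) / betaPW βm βp α t) t)
    (hG : ∀ j ∈ Finset.Icc 1 p, b₀ * (deriv u (G j) - (Polynomial.derivative q).eval (G j))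
      = K + γ * e (G j) + c * S (G j)) :
    |ρ r - ρ l|
      ≤ 2 * ((max βm βp + |γ| + c) * (W * hm ^ (p + 1))) / min βm βp * (r - l) := by
  have hLR : L < R := hL.trans_lt (hlr.trans_le hR)
  have hW := hu.nonneg hLR
  have hlI : l ∈ Icc L R := ⟨hL, hlr.le.trans hR⟩
  have hh0 : 0 < r - l := sub_pos.2 hlr
  have hm0 : 0 < hm := hh0.trans_le hh
  have hb₀pos : 0 < b₀ := hb₀ l (left_mem_Icc.2 hlr.le) ▸ betaPW_pos hβm hβp α l
  have hb₀le : b₀ ≤ max βm βp := hb₀ l (left_mem_Icc.2 hlr.le) ▸ betaPW_le_max βm βp α l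
  set ε := W * hm ^ (p + 1) with hε
  have hε0 : 0 ≤ ε := by positivity
  have hdist : ∀ t ∈ Icc l r, W * |t - l| ^ (p + 1) ≤ ε := by
    intro t ht
    have : |t - l| ≤ hm := by
      rw [abs_of_nonneg (sub_nonneg.2 ht.1)]
      linarith [ht.2]
    rw [hε]
    gcongr
  set Q₀ := taylorPoly (fun i => iteratedDerivWithin i u (Icc L R) l) l p
  set Q₁ := taylorPoly (fun i => iteratedDerivWithin (i + 1) u (Icc L R) l) l p
  have hQ₀d : Q₀.natDegree ≤ p := natDegree_taylorPoly_le _ _ _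
  have hQ₁d : Q₁.natDegree ≤ p := natDegree_taylorPoly_le _ _ _
  have hQ₀ : ∀ t ∈ Icc l r, |u t - Q₀.eval t| ≤ ε := fun t ht =>
    (hu.abs_sub_taylorPoly_le hLR (by omega) hlI ⟨hL.trans ht.1, ht.2.trans hR⟩).trans
      (hdist t ht)
  have hQ₁ : ∀ t ∈ Ioo l r, |deriv u t - Q₁.eval t| ≤ ε := fun t ht =>
    (hu.abs_deriv_sub_taylorPoly_le hLR hpm hlI ⟨hL.trans_lt ht.1, ht.2.trans_le hR⟩).trans
      (hdist t (Ioo_subset_Icc_self ht))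
  obtain ⟨P, hPd, hP⟩ := exists_antiderivative (Q₀ - q)
  have hQq : (Q₀ - q).natDegree ≤ p :=
    (Polynomial.natDegree_sub_le_of_le hQ₀d hq).trans (max_self _).le
  have hSP : ∀ t ∈ Icc l r, |S t - (S l + (P.eval t - P.eval l))| ≤ ε := by
    intro t ht
    have hSc : Continuous S := continuous_iff_continuousAt.2 fun t => (hS t).continuousAt
    have h := abs_sub_le_of_abs_deriv_le_off_point (α := α) (M := ε) ht.1
      (F := fun x => S x - P.eval x) (by fun_prop)
      (fun s _ _ => (hS s).sub (P.hasDerivAt s)) (fun s hs _ => by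
        have hs' : s ∈ Icc l r := ⟨hs.1.le, hs.2.le.trans ht.2⟩
        rw [hP, he s hs', Polynomial.eval_sub, sub_sub_sub_cancel_right]
        exact hQ₀ s hs')
    have h1 : ε * (t - l) ≤ ε * 1 :=
      mul_le_mul_of_nonneg_left (by linarith [ht.2]) hε0
    calc |S t - (S l + (P.eval t - P.eval l))|
        = |S t - P.eval t - (S l - P.eval l)| := by congr 1; ring
      _ ≤ ε := by linarith
  set F : Polynomial ℝ := Polynomial.C b₀ * (Q₁ - Polynomial.derivative q) - Polynomial.C K
    - Polynomial.C γ * (Q₀ - q) - Polynomial.C c * (Polynomial.C (S l - P.eval l) + P) with hF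
  have hFd : F.natDegree ≤ 2 * p - 1 := by
    have hq' : (Polynomial.derivative q).natDegree ≤ p :=
      (Polynomial.natDegree_derivative_le q).trans (by omega)
    have h1 : (Polynomial.C b₀ * (Q₁ - Polynomial.derivative q)).natDegree ≤ 2 * p - 1 :=
      (Polynomial.natDegree_C_mul_le _ _).trans
        ((Polynomial.natDegree_sub_le_of_le hQ₁d hq').trans (by omega))
    have h2 : (Polynomial.C γ * (Q₀ - q)).natDegree ≤ 2 * p - 1 :=
      (Polynomial.natDegree_C_mul_le _ _).trans (by omega)
    have h3 : (Polynomial.C c * (Polynomial.C (S l - P.eval l) + P)).natDegree ≤ 2 * p - 1 := by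
      refine (Polynomial.natDegree_C_mul_le _ _).trans ?_
      rw [Polynomial.natDegree_C_add]
      omega
    refine (Polynomial.natDegree_sub_le_of_le (Polynomial.natDegree_sub_le_of_le
      (Polynomial.natDegree_sub_C.trans_le h1) h2) h3).trans ?_
    simp
  have hclose : ∀ t ∈ Ioo l r,
      |b₀ * (deriv u t - (Polynomial.derivative q).eval t) - (K + γ * e t + c * S t) - F.eval t|
        ≤ (max βm βp + |γ| + c) * ε := by
    intro t ht
    have ht' := Ioo_subset_Icc_self ht
    have h1 : b₀ * (deriv u t - (Polynomial.derivative q).eval t) - (K + γ * e t + c * S t)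
        - F.eval t = b₀ * (deriv u t - Q₁.eval t) + -(γ * (u t - Q₀.eval t))
          + -(c * (S t - (S l + (P.eval t - P.eval l)))) := by
      rw [hF, he t ht']
      simp only [Polynomial.eval_sub, Polynomial.eval_mul, Polynomial.eval_C, Polynomial.eval_add]
      ring
    rw [h1]
    refine (abs_add_three _ _ _).trans ?_
    rw [abs_neg, abs_neg, abs_mul, abs_mul, abs_mul, abs_of_pos hb₀pos, abs_of_pos hc,
      add_mul, add_mul]
    have := hQ₁ t ht
    have := hQ₀ t ht'
    have := hSP t ht'
    gcongr
  refine abs_sub_le_of_residual_near_polynomial hβm hβp hlr.le hA hquad hFd (by positivity) hρ hρ'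
    (fun t ht hne => ?_) (fun j hj => ?_)
  · have hb := hb₀ t (Ioo_subset_Icc_self ht)
    rw [hb, mul_sub, mul_div_cancel₀ _ hb₀pos.ne']
    exact hclose t ht
  · have h := hclose (G j) (hGmem j hj)
    rwa [hG j hj, sub_self, zero_sub, abs_neg] at h

lemma SmoothPiece.mono {m : ℕ} {L R W W' : ℝ} {u : ℝ → ℝ} (h : SmoothPiece m L R W u)
    (hW : W ≤ W') : SmoothPiece m L R W' u :=
  ⟨h.1, fun j hj t ht => (h.2 j hj t ht).trans hW⟩

lemma ContDiffOn.smoothPiece {m : ℕ} {L R : ℝ} {u : ℝ → ℝ} (hLR : L < R)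
    (hu : ContDiffOn ℝ (m : ℕ∞) u (Icc L R)) :
    SmoothPiece m L R (sSup {y : ℝ | ∃ j ≤ m, ∃ t ∈ Icc L R,
      y = |iteratedDerivWithin j u (Icc L R) t|}) u := by
  refine ⟨hu, fun j hj t ht => le_csSup ?_ ⟨j, hj, t, ht, rfl⟩⟩
  have h1 : ∀ i ≤ m, ∃ M, ∀ t ∈ Icc L R, |iteratedDerivWithin i u (Icc L R) t| ≤ M := fun i hi =>
    isCompact_Icc.exists_bound_of_continuousOn (hu.continuousOn_iteratedDerivWithin
      (by exact_mod_cast hi) (uniqueDiffOn_Icc hLR))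
  choose! M hM using h1
  obtain ⟨B, hB⟩ := ((finite_Iic m).image M).bddAbove
  refine ⟨B, ?_⟩
  rintro _ ⟨i, hi, s, hs, rfl⟩
  exact (hM i hi s hs).trans (hB (mem_image_of_mem M hi))

lemma exists_continuous_extension {a b : ℝ} (hab : a ≤ b) {v : ℝ → ℝ}
    (hv : ContinuousOn v (Icc a b)) : ∃ e : ℝ → ℝ, Continuous e ∧ ∀ t ∈ Icc a b, e t = v t :=
  ⟨IccExtend hab ((Icc a b).domRestrict v), hv.domRestrict.Icc_extend', fun t ht => by
    rw [IccExtend_of_mem _ _ ht, domRestrict_apply]⟩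

/-- The fundamental theorem of calculus for a bounded derivative with countably many exceptions. -/
lemma integral_eq_sub_off_countable {F w : ℝ → ℝ} {l r M : ℝ} {s : Set ℝ} (hlr : l ≤ r)
    (hs : s.Countable) (hF : ContinuousOn F (Icc l r))
    (hF' : ∀ t ∈ Ioo l r, t ∉ s → HasDerivAt F (w t) t)
    (hw : ∀ t ∈ Ioo l r, t ∉ s → |w t| ≤ M) : ∫ t in l..r, w t = F r - F l := by
  rw [← (integral_deriv_off_countable hlr hs hF
    (fun t ht hts => (hF' t ht hts).differentiableAt)
    (fun t ht hts => (hF' t ht hts).deriv ▸ hw t ht hts)).2]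
  refine intervalIntegral.integral_congr_ae ?_
  have h0 := (hs.insert r).ae_notMem MeasureTheory.volume
  filter_upwards [h0] with t ht hmem
  rw [uIoc_of_le hlr] at hmem
  simp only [mem_insert_iff, not_or] at ht
  exact ((hF' t ⟨hmem.1, lt_of_le_of_ne hmem.2 ht.1⟩ ht.2).deriv).symm

lemma mesh_mono {N : ℕ} {x : ℕ → ℝ} (hx : ∀ i, i < N → x i < x (i + 1)) {i j : ℕ} (hij : i ≤ j)
    (hj : j ≤ N) : x i ≤ x j := by
  induction j, hij using Nat.le_induction with
  | base => exact le_rfl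
  | succ n _ ih => exact (ih (by omega)).trans (hx n (by omega)).le

lemma exists_element {N : ℕ} {x : ℕ → ℝ} (hN : 1 ≤ N) {t : ℝ} (h0 : x 0 ≤ t) (ht : t ≤ x N) :
    ∃ i, 1 ≤ i ∧ i ≤ N ∧ t ∈ Icc (x (i - 1)) (x i) := by
  induction N, hN using Nat.le_induction with
  | base => exact ⟨1, le_rfl, le_rfl, h0, ht⟩
  | succ n _ ih =>
    rcases le_total t (x n) with h | h
    · obtain ⟨i, h1, h2, h3⟩ := ih h
      exact ⟨i, h1, h2.trans n.le_succ, h3⟩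
    · exact ⟨n + 1, by omega, le_rfl, h, ht⟩

/-- Accumulation of the local increments of `ρ`, one element being exceptional. -/
lemma abs_le_of_mesh_increments {N k : ℕ} {x : ℕ → ℝ} {ρ : ℝ → ℝ} {F B : ℝ} (hN : 1 ≤ N)
    (hx : ∀ i, i < N → x i < x (i + 1)) (hF : 0 ≤ F) (hB : 0 ≤ B) (h0 : ρ (x 0) = 0)
    (hreg : ∀ i, 1 ≤ i → i ≤ N → i ≠ k → |ρ (x i) - ρ (x (i - 1))| ≤ F * (x i - x (i - 1)))
    (hall : ∀ i, 1 ≤ i → i ≤ N → ∀ t ∈ Icc (x (i - 1)) (x i), |ρ t - ρ (x (i - 1))| ≤ B) :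
    ∀ t ∈ Icc (x 0) (x N), |ρ t| ≤ F * (x N - x 0) + 2 * B := by
  have hnode : ∀ i ≤ N, |ρ (x i)| ≤ F * (x i - x 0) + if k ≤ i then B else 0 := by
    intro i
    induction i with
    | zero => intro _; rw [h0, abs_zero, sub_self, mul_zero, zero_add]; split_ifs <;> simp [hB]
    | succ i ih =>
      intro hi
      have h1 := ih (by omega)
      have h2 : |ρ (x (i + 1))| ≤ |ρ (x (i + 1)) - ρ (x i)| + |ρ (x i)| := by
        simpa using abs_add_le (ρ (x (i + 1)) - ρ (x i)) (ρ (x i))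
      by_cases hk : i + 1 = k
      · have h3 := hall (i + 1) (by omega) hi (x (i + 1)) ⟨(hx i hi).le, le_rfl⟩
        simp only [Nat.add_sub_cancel] at h3
        rw [if_neg (by omega)] at h1
        rw [if_pos hk.ge]
        have := mul_le_mul_of_nonneg_left (hx i hi).le hF
        linarith
      · have h3 := hreg (i + 1) (by omega) hi hk
        simp only [Nat.add_sub_cancel] at h3
        have h4 : (if k ≤ i + 1 then B else 0) = if k ≤ i then B else 0 := by
          simp only [show k ≤ i + 1 ↔ k ≤ i by omega]
        rw [h4]
        linarith
  intro t ht
  obtain ⟨i, h1, h2, h3⟩ := exists_element hN ht.1 ht.2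
  have h4 := hnode (i - 1) (by omega)
  have h5 := hall i h1 h2 t h3
  have h6 : |ρ t| ≤ |ρ t - ρ (x (i - 1))| + |ρ (x (i - 1))| := by
    simpa using abs_add_le (ρ t - ρ (x (i - 1))) (ρ (x (i - 1)))
  have h7 := mul_le_mul_of_nonneg_left (mesh_mono hx (show i - 1 ≤ N by omega) le_rfl) hF
  have h8 : (if k ≤ i - 1 then B else 0) ≤ B := by split_ifs <;> simp [hB]
  linarith

lemma eq_first_of_consecutive {N p : ℕ} {J : ℝ → ℝ} {g : ℕ → ℕ → ℝ} (hp : 1 ≤ p)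
    (hg : ∀ i, 1 ≤ i → i < N → g i (p + 1) = g (i + 1) 1)
    (hJ : ∀ i, 1 ≤ i → i ≤ N → ∀ j, 1 ≤ j → j ≤ (if i < N then p else p - 1) →
      J (g i j) = J (g i (j + 1))) :
    ∀ i, 1 ≤ i → i ≤ N → ∀ j, 1 ≤ j → j ≤ p → J (g i j) = J (g 1 1) := by
  have hrow : ∀ i, 1 ≤ i → i ≤ N → ∀ j, 1 ≤ j → j ≤ (if i < N then p else p - 1) + 1 →
      J (g i j) = J (g i 1) := by
    intro i hi hiN j hj
    induction j, hj using Nat.le_induction with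
    | base => exact fun _ => rfl
    | succ j hj ih => exact fun h => (hJ i hi hiN j hj (by omega)).symm.trans (ih (by omega))
  intro i hi
  have hcol : i ≤ N → J (g i 1) = J (g 1 1) := by
    induction i, hi using Nat.le_induction with
    | base => exact fun _ => rfl
    | succ i hi ih =>
      intro h
      rw [← hg i hi h, hrow i hi (by omega) (p + 1) (by omega) (by
        rw [if_pos (Nat.lt_of_succ_le h)])]
      exact ih (by omega)
  intro hiN j hj hjp
  rw [hrow i hi hiN j hj (by split_ifs <;> omega), hcol hiN]

/-- On every element the flux of a trial function is a polynomial of degree `≤ p - 1`. -/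
lemma MemUT.exists_flux_polynomial {p N k : ℕ} {a b α βm βp : ℝ} {x : ℕ → ℝ} {v : ℝ → ℝ}
    (hp : 1 ≤ p) (hx : ∀ i, i < N → x i < x (i + 1)) (hk : 1 ≤ k) (hkN : k ≤ N)
    (hkα : x (k - 1) < α) (hαk : α < x k) (hv : MemUT p N k a b α βm βp x v)
    {i : ℕ} (hi : 1 ≤ i) (hiN : i ≤ N) :
    ∃ s : Polynomial ℝ, s.natDegree ≤ p - 1 ∧ ∀ t ∈ Ioo (x (i - 1)) (x i), t ≠ α →
      DifferentiableAt ℝ v t ∧ betaPW βm βp α t * deriv v t = s.eval t := by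
  obtain ⟨-, -, -, hreg, qm, qp, hqm, hqp, hvm, hvp, hjump⟩ := hv
  have local_eq : ∀ {l r : ℝ} {q : Polynomial ℝ}, (∀ y ∈ Icc l r, v y = q.eval y) →
      ∀ t ∈ Ioo l r, HasDerivAt v ((Polynomial.derivative q).eval t) t := fun h t ht =>
    (Polynomial.hasDerivAt _ t).congr_of_eventuallyEq
      (Filter.eventually_of_mem (Icc_mem_nhds ht.1 ht.2) h)
  have hdeg : ∀ {q : Polynomial ℝ} (b₀ : ℝ), q.natDegree ≤ p →
      (Polynomial.C b₀ * Polynomial.derivative q).natDegree ≤ p - 1 := fun b₀ hq =>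
    (Polynomial.natDegree_C_mul_le _ _).trans ((Polynomial.natDegree_derivative_le _).trans
      (Nat.sub_le_sub_right hq 1))
  rcases lt_trichotomy i k with h | rfl | h
  · obtain ⟨q, hq, hvq⟩ := hreg i hi hiN h.ne
    refine ⟨Polynomial.C βm * Polynomial.derivative q, hdeg _ hq, fun t ht _ => ?_⟩
    have h1 := local_eq hvq t ht
    have h2 := mesh_mono hx (show i ≤ k - 1 by omega) (by omega)
    rw [betaPW_of_lt (by linarith [ht.2]), h1.deriv, Polynomial.eval_mul, Polynomial.eval_C]
    exact ⟨h1.differentiableAt, rfl⟩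
  · have hfl := interface_flux_eq hp hqm hqp hjump
    refine ⟨Polynomial.C βm * Polynomial.derivative qm, hdeg _ hqm, fun t ht hne => ?_⟩
    rcases hne.lt_or_gt with h | h
    · have h1 := local_eq hvm t ⟨ht.1, h⟩
      rw [betaPW_of_lt h, h1.deriv, Polynomial.eval_mul, Polynomial.eval_C]
      exact ⟨h1.differentiableAt, rfl⟩
    · have h1 := local_eq hvp t ⟨h, ht.2⟩
      rw [hfl, betaPW_of_gt h, h1.deriv, Polynomial.eval_mul, Polynomial.eval_C]
      exact ⟨h1.differentiableAt, rfl⟩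
  · obtain ⟨q, hq, hvq⟩ := hreg i hi hiN h.ne'
    refine ⟨Polynomial.C βp * Polynomial.derivative q, hdeg _ hq, fun t ht _ => ?_⟩
    have h1 := local_eq hvq t ht
    have h2 := mesh_mono hx (show k ≤ i - 1 by omega) (by omega)
    rw [betaPW_of_gt (by linarith [ht.1]), h1.deriv, Polynomial.eval_mul, Polynomial.eval_C]
    exact ⟨h1.differentiableAt, rfl⟩

/-- Integration of the convection and reaction terms of a trial function. -/
lemma MemUT.integral_lower_order_eq {p N k : ℕ} {a b α βm βp γ c : ℝ} {x : ℕ → ℝ} {v ve : ℝ → ℝ}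
    (hβm : 0 < βm) (hβp : 0 < βp) (hN : 1 ≤ N) (hxa : x 0 = a) (hxb : x N = b)
    (hp : 1 ≤ p) (hx : ∀ i, i < N → x i < x (i + 1)) (hk : 1 ≤ k) (hkN : k ≤ N)
    (hkα : x (k - 1) < α) (hαk : α < x k) (hv : MemUT p N k a b α βm βp x v)
    (hve : Continuous ve) (heq : ∀ t ∈ Icc a b, ve t = v t) {l r : ℝ} (hl : a ≤ l) (hlr : l ≤ r)
    (hr : r ≤ b) :
    ∫ t in l..r, (γ * deriv v t + c * v t)
      = γ * (v r - v l) + c * ((∫ y in a..r, ve y) - ∫ y in a..l, ve y) := by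
  have hbound : ∀ i, 1 ≤ i → i ≤ N → ∃ M, ∀ t ∈ Ioo (x (i - 1)) (x i), t ≠ α →
      |γ * deriv v t + c * v t| ≤ M := by
    intro i hi hiN
    obtain ⟨s, -, hs⟩ := hv.exists_flux_polynomial hp hx hk hkN hkα hαk hi hiN
    obtain ⟨M, hM⟩ := isCompact_Icc.exists_bound_of_continuousOn (s := Icc (x (i - 1)) (x i))
      (f := fun t => s.eval t) (by fun_prop)
    obtain ⟨M', hM'⟩ := isCompact_Icc.exists_bound_of_continuousOn hv.1
    refine ⟨|γ| * (M / min βm βp) + |c| * M', fun t ht hne => ?_⟩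
    have hb := betaPW_pos hβm hβp α t
    have h1 := hM t (Ioo_subset_Icc_self ht)
    have htab : t ∈ Icc a b :=
      ⟨hxa ▸ (mesh_mono hx (Nat.zero_le _) (by omega)).trans ht.1.le,
        hxb ▸ ht.2.le.trans (mesh_mono hx hiN le_rfl)⟩
    have h2 := hM' t htab
    have h3 : deriv v t = s.eval t / betaPW βm βp α t := by
      rw [← (hs t ht hne).2]
      field_simp
    have h4 : |deriv v t| ≤ M / min βm βp := by
      rw [h3, abs_div, abs_of_pos hb]
      exact div_le_div₀ ((abs_nonneg _).trans h1) h1 (lt_min hβm hβp) (min_le_betaPW _ _ _ _)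
    refine (abs_add_le _ _).trans ?_
    rw [abs_mul, abs_mul]
    rw [Real.norm_eq_abs] at h2
    gcongr
  choose! M hM using hbound
  obtain ⟨B, hB⟩ := ((finite_Iic N).image M).bddAbove
  have hfin : ((x '' Iic N) ∪ {α} : Set ℝ).Countable :=
    (((finite_Iic N).image x).union (finite_singleton α)).countable
  have helem : ∀ t ∈ Ioo l r, t ∉ (x '' Iic N) ∪ {α} → t ≠ α ∧
      ∃ i, 1 ≤ i ∧ i ≤ N ∧ t ∈ Ioo (x (i - 1)) (x i) := by
    intro t ht hts
    simp only [mem_union, mem_image, mem_Iic, mem_singleton_iff, not_or, not_exists, not_and] at hts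
    obtain ⟨i, h1, h2, h3⟩ := exists_element (x := x) (t := t) hN (by linarith [ht.1])
      (by linarith [ht.2])
    exact ⟨hts.2, i, h1, h2, lt_of_le_of_ne h3.1 (hts.1 (i - 1) (by omega)),
      lt_of_le_of_ne h3.2 (Ne.symm (hts.1 i h2))⟩
  have hder : ∀ t, HasDerivAt (fun t => ∫ y in a..t, ve y) (ve t) t := fun t =>
    hve.integral_hasStrictDerivAt a t |>.hasDerivAt
  have hcont : Continuous fun t => ∫ y in a..t, ve y :=
    continuous_iff_continuousAt.2 fun t => (hder t).continuousAt
  rw [integral_eq_sub_off_countable (F := fun t => γ * v t + c * ∫ y in a..t, ve y) (M := B) hlr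
    hfin (((hv.1.mono (Icc_subset_Icc hl hr)).const_smul γ).add (hcont.const_smul c).continuousOn)
    (fun t ht hts => ?_) (fun t ht hts => ?_)]
  · ring
  · obtain ⟨hne, i, h1, h2, h3⟩ := helem t ht hts
    obtain ⟨s, -, hs⟩ := hv.exists_flux_polynomial hp hx hk hkN hkα hαk h1 h2
    have h4 := hder t
    rw [heq t ⟨hl.trans ht.1.le, ht.2.le.trans hr⟩] at h4
    exact ((hs t h3 hne).1.hasDerivAt.const_mul γ).add (h4.const_mul c)
  · obtain ⟨hne, i, h1, h2, h3⟩ := helem t ht hts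
    exact (hM i h1 h2 t h3 hne).trans (hB (mem_image_of_mem M h2))

/-- The exact solution satisfies the balance equation on every subinterval. -/
lemma integral_source_eq {m : ℕ} {a b α βm βp γ c Mf l r : ℝ} {f u ue : ℝ → ℝ} (hm : 2 ≤ m)
    (hα : α ∈ Ioo a b) (hu : MemW m a b α βm βp u)
    (hf : ∀ t ∈ Icc a b, |f t| ≤ Mf)
    (hode : ∀ t, t ∈ Ioo a α ∪ Ioo α b →
      -(betaPW βm βp α t * iteratedDeriv 2 u t) + γ * deriv u t + c * u t = f t)
    (hue : Continuous ue) (heq : ∀ t ∈ Icc a b, ue t = u t) (hl : a < l) (hlr : l ≤ r)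
    (hr : r < b) (hlα : l ≠ α) (hrα : r ≠ α) :
    ∫ t in l..r, f t = betaPW βm βp α l * deriv u l - betaPW βm βp α r * deriv u r
      + γ * (u r - u l) + c * ((∫ y in a..r, ue y) - ∫ y in a..l, ue y) := by
  obtain ⟨huc, -, -, hum, hup, hjump⟩ := hu
  have hm2 : (2 : WithTop ℕ∞) ≤ ((m : ℕ∞) : WithTop ℕ∞) :=
    WithTop.coe_le_coe.2 (Nat.ofNat_le_cast.2 hm)
  have hcd : ∀ {L R : ℝ}, L < R → ContDiffOn ℝ (m : ℕ∞) u (Icc L R) →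
      ContDiffOn ℝ 1 (derivWithin u (Icc L R)) (Icc L R) := fun hLR h =>
    h.derivWithin (uniqueDiffOn_Icc hLR) (one_add_one_eq_two.trans_le hm2)
  have hdd : ∀ {L R : ℝ}, L < R → ContDiffOn ℝ (m : ℕ∞) u (Icc L R) → ∀ t ∈ Ioo L R,
      HasDerivAt u (deriv u t) t ∧ HasDerivAt (deriv u) (iteratedDeriv 2 u t) t := by
    intro L R hLR h t ht
    have hn := Icc_mem_nhds ht.1 ht.2
    have h2 : ContDiffAt ℝ 2 u t := (h.contDiffAt hn).of_le hm2
    refine ⟨(h2.differentiableAt (by norm_num)).hasDerivAt, ?_⟩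
    rw [iteratedDeriv_succ, iteratedDeriv_one]
    have h3 := h2.derivWithin (m := 1) one_add_one_eq_two.le
    exact (h3.differentiableAt (by norm_num)).hasDerivAt
  set v : ℝ → ℝ := fun t => if t ≤ α then βm * derivWithin u (Icc a α) t
    else βp * derivWithin u (Icc α b) t with hv
  have hvm : EqOn v (fun t => βm * derivWithin u (Icc a α) t) (Icc a α) := fun t ht =>
    if_pos ht.2
  have hvp : EqOn v (fun t => βp * derivWithin u (Icc α b) t) (Icc α b) := by
    intro t ht
    rcases ht.1.eq_or_lt with rfl | h
    · have := hjump 1 le_rfl (by omega)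
      simp only [iteratedDerivWithin_one] at this
      simp only [hv, le_refl, if_true, this]
    · exact if_neg h.not_ge
  have hvc : ContinuousOn v (Icc a b) := by
    rw [← Icc_union_Icc_eq_Icc hα.1.le hα.2.le]
    exact ((((hcd hα.1 hum).continuousOn).const_smul βm).congr hvm).union_of_isClosed
      ((((hcd hα.2 hup).continuousOn).const_smul βp).congr hvp) isClosed_Icc isClosed_Icc
  have hveq : ∀ t ∈ Ioo a b, t ≠ α → v t = betaPW βm βp α t * deriv u t := by
    intro t ht hne
    rcases hne.lt_or_gt with h | h
    · rw [hvm ⟨ht.1.le, h.le⟩, betaPW_of_lt h, SmoothPiece.deriv_eq ⟨ht.1, h⟩]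
    · rw [hvp ⟨h.le, ht.2.le⟩, betaPW_of_gt h, SmoothPiece.deriv_eq ⟨h, ht.2⟩]
  have hu2 : ∀ t ∈ Ioo a b, t ≠ α →
      HasDerivAt u (deriv u t) t ∧ HasDerivAt (deriv u) (iteratedDeriv 2 u t) t := by
    intro t ht hne
    rcases hne.lt_or_gt with h | h
    · exact hdd hα.1 hum t ⟨ht.1, h⟩
    · exact hdd hα.2 hup t ⟨h, ht.2⟩
  have hder : ∀ t, HasDerivAt (fun t => ∫ y in a..t, ue y) (ue t) t := fun t =>
    hue.integral_hasStrictDerivAt a t |>.hasDerivAt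
  have hcont : Continuous fun t => ∫ y in a..t, ue y :=
    continuous_iff_continuousAt.2 fun t => (hder t).continuousAt
  have hsub : Icc l r ⊆ Icc a b := Icc_subset_Icc hl.le hr.le
  rw [integral_eq_sub_off_countable (s := {α}) (M := Mf)
    (F := fun t => -v t + γ * u t + c * ∫ y in a..t, ue y) hlr (countable_singleton α)
    (((hvc.mono hsub).neg.add ((huc.mono hsub).const_smul γ)).add
      (hcont.const_smul c).continuousOn)
    (fun t ht hne => ?_) (fun t ht _ => hf t (hsub (Ioo_subset_Icc_self ht)))]
  · simp only [hveq l ⟨hl, hlr.trans_lt hr⟩ hlα, hveq r ⟨hl.trans_le hlr, hr⟩ hrα]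
    ring
  · have htab : t ∈ Ioo a b := ⟨hl.trans ht.1, ht.2.trans hr⟩
    have hmem : t ∈ Ioo a α ∪ Ioo α b := by
      rcases (Ne.lt_or_gt hne : t < α ∨ α < t) with h | h
      · exact Or.inl ⟨htab.1, h⟩
      · exact Or.inr ⟨h, htab.2⟩
    have h4 := hder t
    rw [heq t (Ioo_subset_Icc_self htab)] at h4
    obtain ⟨h5, h6⟩ := hu2 t htab hne
    have h7 : HasDerivAt v (betaPW βm βp α t * iteratedDeriv 2 u t) t := by
      refine (h6.const_mul (betaPW βm βp α t)).congr_of_eventuallyEq ?_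
      filter_upwards [eventuallyEq_betaPW (βm := βm) (βp := βp) hne, Ioo_mem_nhds htab.1 htab.2,
        isOpen_ne.mem_nhds hne] with y hy1 hy2 hy3
      rw [hveq y hy2 hy3, hy1]
    rw [← hode t hmem]
    exact (h7.neg.add (h5.const_mul γ)).add (h4.const_mul c)

/-- A mesh of `[a, b]` with generalized Gauss points `g` and weights `A`, the interface point `α`
lying inside the `k`-th element. -/
structure IsGaussMesh (p N k : ℕ) (a b α βm βp : ℝ) (x : ℕ → ℝ) (g A : ℕ → ℕ → ℝ) : Prop where
  one_le_k : 1 ≤ k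
  k_le : k ≤ N
  left : x 0 = a
  right : x N = b
  step : ∀ i, i < N → x i < x (i + 1)
  lt_interface : x (k - 1) < α
  interface_lt : α < x k
  gauss_mem : ∀ i, 1 ≤ i → i ≤ N → ∀ j ∈ Finset.Icc 1 p, g i j ∈ Ioo (x (i - 1)) (x i) ∧ g i j ≠ α
  gauss_lt : ∀ i, 1 ≤ i → i ≤ N → ∀ j, 1 ≤ j → j < p → g i j < g i (j + 1)
  gauss_next : ∀ i, 1 ≤ i → i < N → g i (p + 1) = g (i + 1) 1
  weight_pos : ∀ i, 1 ≤ i → i ≤ N → ∀ j ∈ Finset.Icc 1 p, 0 < A i j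
  quad : ∀ i, 1 ≤ i → i ≤ N → ∀ F : Polynomial ℝ, F.natDegree ≤ 2 * p - 1 →
    ∑ j ∈ Finset.Icc 1 p, A i j * F.eval (g i j)
      = ∫ t in (x (i - 1))..(x i), F.eval t / betaPW βm βp α t

namespace IsGaussMesh

variable {p N k : ℕ} {a b α βm βp : ℝ} {x : ℕ → ℝ} {g A : ℕ → ℕ → ℝ}

lemma one_le_N (hM : IsGaussMesh p N k a b α βm βp x g A) : 1 ≤ N := hM.one_le_k.trans hM.k_le

lemma left_le (hM : IsGaussMesh p N k a b α βm βp x g A) {i : ℕ} (hi : i ≤ N) : a ≤ x i :=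
  hM.left ▸ mesh_mono hM.step i.zero_le hi

lemma le_right (hM : IsGaussMesh p N k a b α βm βp x g A) {i : ℕ} (hi : i ≤ N) : x i ≤ b :=
  hM.right ▸ mesh_mono hM.step hi le_rfl

lemma element_lt (hM : IsGaussMesh p N k a b α βm βp x g A) {i : ℕ} (hi : 1 ≤ i) (hiN : i ≤ N) :
    x (i - 1) < x i := by
  have := hM.step (i - 1) (by omega)
  rwa [Nat.sub_add_cancel hi] at this

lemma interface_mem (hM : IsGaussMesh p N k a b α βm βp x g A) : α ∈ Ioo a b :=
  ⟨(hM.left_le (by have := hM.k_le; omega)).trans_lt hM.lt_interface,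
    hM.interface_lt.trans_le (hM.le_right hM.k_le)⟩

lemma gauss_mem_Ioo (hM : IsGaussMesh p N k a b α βm βp x g A) {i j : ℕ} (hi : 1 ≤ i)
    (hiN : i ≤ N) (hj : j ∈ Finset.Icc 1 p) : g i j ∈ Ioo a b :=
  ⟨(hM.left_le (by omega)).trans_lt (hM.gauss_mem i hi hiN j hj).1.1,
    (hM.gauss_mem i hi hiN j hj).1.2.trans_le (hM.le_right hiN)⟩

/-- Consecutive Gauss points: both are Gauss points of the mesh, in increasing order. -/
lemma gauss_succ (hM : IsGaussMesh p N k a b α βm βp x g A) (hp : 1 ≤ p) {i j : ℕ} (hi : 1 ≤ i)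
    (hiN : i ≤ N) (hj : 1 ≤ j) (hjp : j ≤ if i < N then p else p - 1) :
    g i j < g i (j + 1) ∧ g i (j + 1) ∈ Ioo a b ∧ g i (j + 1) ≠ α := by
  by_cases hjlt : j < p
  · have hmem : j + 1 ∈ Finset.Icc 1 p := Finset.mem_Icc.2 ⟨by omega, hjlt⟩
    exact ⟨hM.gauss_lt i hi hiN j hj hjlt, hM.gauss_mem_Ioo hi hiN hmem,
      (hM.gauss_mem i hi hiN _ hmem).2⟩
  · have hiN' : i < N := by
      by_contra h
      rw [if_neg h] at hjp
      omega
    rw [if_pos hiN'] at hjp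
    obtain rfl : j = p := by omega
    have h1 : 1 ∈ Finset.Icc 1 j := Finset.mem_Icc.2 ⟨le_rfl, hp⟩
    have h2 := hM.gauss_mem i hi hiN j (Finset.mem_Icc.2 ⟨hj, le_rfl⟩)
    have h3 := hM.gauss_mem (i + 1) (by omega) hiN' 1 h1
    rw [hM.gauss_next i hi hiN']
    exact ⟨h2.1.2.trans h3.1.1, hM.gauss_mem_Ioo (by omega) hiN' h1, h3.2⟩

/-- At the Gauss points the flux error differs from the lower-order terms by a constant. -/
lemma exists_flux_error_eq {γ c Mf : ℝ} {m : ℕ} {f u uT ue uTe : ℝ → ℝ}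
    (hM : IsGaussMesh p N k a b α βm βp x g A) (hβm : 0 < βm) (hβp : 0 < βp) (hp : 1 ≤ p)
    (hm : 2 ≤ m) (hf : ∀ t ∈ Icc a b, |f t| ≤ Mf) (hu : MemW m a b α βm βp u)
    (hode : ∀ t, t ∈ Ioo a α ∪ Ioo α b →
      -(betaPW βm βp α t * iteratedDeriv 2 u t) + γ * deriv u t + c * u t = f t)
    (huT : MemUT p N k a b α βm βp x uT)
    (hscheme : ∀ i, 1 ≤ i → i ≤ N → ∀ j, 1 ≤ j → j ≤ (if i < N then p else p - 1) →
      betaPW βm βp α (g i j) * deriv uT (g i j)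
        - betaPW βm βp α (g i (j + 1)) * deriv uT (g i (j + 1))
        + (∫ t in (g i j)..(g i (j + 1)), (γ * deriv uT t + c * uT t))
        = ∫ t in (g i j)..(g i (j + 1)), f t)
    (hue : Continuous ue) (hueq : ∀ t ∈ Icc a b, ue t = u t)
    (huTe : Continuous uTe) (huTeq : ∀ t ∈ Icc a b, uTe t = uT t) :
    ∃ K, ∀ i, 1 ≤ i → i ≤ N → ∀ j ∈ Finset.Icc 1 p,
      betaPW βm βp α (g i j) * (deriv u (g i j) - deriv uT (g i j))
        = K + γ * (ue (g i j) - uTe (g i j)) + c * ∫ y in a..g i j, (ue y - uTe y) := by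
  set J : ℝ → ℝ := fun t => betaPW βm βp α t * (deriv u t - deriv uT t)
    - γ * (ue t - uTe t) - c * ∫ y in a..t, (ue y - uTe y) with hJ
  refine ⟨J (g 1 1), fun i hi hiN j hj => ?_⟩
  rw [Finset.mem_Icc] at hj
  rw [← eq_first_of_consecutive (J := J) hp hM.gauss_next ?_ i hi hiN j hj.1 hj.2]
  · simp only [hJ]
    ring
  intro i hi hiN j hj hjp
  have hjm : j ∈ Finset.Icc 1 p := Finset.mem_Icc.2 ⟨hj, hjp.trans (by split_ifs <;> omega)⟩
  have h1 := hM.gauss_mem_Ioo hi hiN hjm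
  have h1' := (hM.gauss_mem i hi hiN j hjm).2
  obtain ⟨hlt, h2, h2'⟩ := hM.gauss_succ hp hi hiN hj hjp
  have hs := hscheme i hi hiN j hj hjp
  rw [integral_source_eq hm hM.interface_mem hu hf hode hue hueq h1.1 hlt.le h2.2 h1' h2',
    huT.integral_lower_order_eq hβm hβp hM.one_le_N hM.left hM.right hp hM.step hM.one_le_k
      hM.k_le hM.lt_interface hM.interface_lt huTe huTeq h1.1.le hlt.le h2.2.le] at hs
  simp only [hJ]
  rw [intervalIntegral.integral_sub (hue.intervalIntegrable _ _) (huTe.intervalIntegrable _ _),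
    intervalIntegral.integral_sub (hue.intervalIntegrable _ _) (huTe.intervalIntegrable _ _),
    hueq _ (Ioo_subset_Icc_self h1), hueq _ (Ioo_subset_Icc_self h2),
    huTeq _ (Ioo_subset_Icc_self h1), huTeq _ (Ioo_subset_Icc_self h2)]
  linarith

/-- The defect of the error equation: of optimal order on the regular elements, and of one order
less on the interface element. -/
lemma abs_defect_le {γ c W K E Λ hm : ℝ} {m : ℕ} {u uT e : ℝ → ℝ}
    (hM : IsGaussMesh p N k a b α βm βp x g A) (hβm : 0 < βm) (hβp : 0 < βp) (hc : 0 < c)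
    (hp : 2 ≤ p) (hpm : p + 2 ≤ m) (hΛ0 : 0 < Λ) (hh : ∀ i, 1 ≤ i → i ≤ N → x i - x (i - 1) ≤ hm)
    (hm1 : hm ≤ 1)
    (hΛ : ∀ (l r δ : ℝ) (G A : ℕ → ℝ) (B : Polynomial ℝ), l < r →
      (∀ j ∈ Finset.Icc 1 p, 0 < A j) →
      (∀ F : Polynomial ℝ, F.natDegree ≤ 2 * p - 1 →
        ∑ j ∈ Finset.Icc 1 p, A j * F.eval (G j) = ∫ t in l..r, F.eval t / betaPW βm βp α t) →
      B.natDegree ≤ p - 1 → 0 ≤ δ → (∀ j ∈ Finset.Icc 1 p, |B.eval (G j)| ≤ δ) →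
      ∀ t ∈ Icc l r, |B.eval t| ≤ Λ * δ)
    (hum : SmoothPiece m a α W u) (hup : SmoothPiece m α b W u)
    (hjump : ∀ j, 1 ≤ j → j ≤ m → βm * iteratedDerivWithin j u (Icc a α) α
      = βp * iteratedDerivWithin j u (Icc α b) α)
    (huT : MemUT p N k a b α βm βp x uT) (he : Continuous e) (hea : e a = 0)
    (heq : ∀ t ∈ Icc a b, e t = u t - uT t) (hE : ∀ t ∈ Icc a b, |e t| ≤ E)
    (hG : ∀ i, 1 ≤ i → i ≤ N → ∀ j ∈ Finset.Icc 1 p,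
      betaPW βm βp α (g i j) * (deriv u (g i j) - deriv uT (g i j))
        = K + γ * e (g i j) + c * ∫ y in a..g i j, e y) :
    ∀ t ∈ Icc a b, |e t - ∫ s in a..t, (K + γ * e s + c * ∫ y in a..s, e y) / betaPW βm βp α s|
      ≤ 2 * ((max βm βp + |γ| + c) * (W * hm ^ (p + 1))) / min βm βp * (b - a)
        + 2 * ((1 + Λ) * (max βm βp * W * hm ^ p + (|γ| + c * (b - a)) * E) / min βm βp * hm) := by
  have hlo := lt_min hβm hβp
  have hhi : 0 < max βm βp := lt_max_of_lt_left hβm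
  have hα := hM.interface_mem
  have hab : a < b := hα.1.trans hα.2
  have hW := hum.nonneg hα.1
  have hE0 : 0 ≤ E := (abs_nonneg _).trans (hE a (left_mem_Icc.2 hab.le))
  have hm0 : 0 < hm := (sub_pos.2 (hM.element_lt hM.one_le_k hM.k_le)).trans_le
    (hh k hM.one_le_k hM.k_le)
  set S : ℝ → ℝ := fun t => ∫ y in a..t, e y with hSdef
  have hS : ∀ t, HasDerivAt S (e t) t := fun t => (he.integral_hasStrictDerivAt a t).hasDerivAt
  have hSc : Continuous S := continuous_iff_continuousAt.2 fun t => (hS t).continuousAt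
  have hw : Continuous fun s => K + γ * e s + c * S s := by fun_prop
  have hSb : ∀ t ∈ Icc a b, |S t| ≤ (b - a) * E := by
    intro t ht
    have h := abs_sub_le_of_abs_deriv_le_off_point (α := α) (M := E) ht.1 hSc.continuousOn
      (fun s _ _ => hS s) (fun s hs _ => hE s ⟨hs.1.le, hs.2.le.trans ht.2⟩)
    have h0 : S a = 0 := by simp [hSdef]
    rw [h0, sub_zero] at h
    refine h.trans ?_
    rw [mul_comm]
    gcongr
    exact ht.2
  set ρ : ℝ → ℝ := fun t => e t - ∫ s in a..t, (K + γ * e s + c * S s) / betaPW βm βp α s with hρ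
  have hρc : Continuous ρ := he.sub (continuous_integral_div_betaPW hβm hβp hw α a)
  have hud : ∀ t ∈ Ioo a b, t ≠ α → DifferentiableAt ℝ u t := by
    intro t ht hne
    rcases hne.lt_or_gt with h | h
    · exact hum.differentiableAt (by omega) ⟨ht.1, h⟩
    · exact hup.differentiableAt (by omega) ⟨h, ht.2⟩
  have hρd : ∀ t ∈ Ioo a b, t ≠ α → DifferentiableAt ℝ uT t →
      HasDerivAt ρ (deriv u t - deriv uT t - (K + γ * e t + c * S t) / betaPW βm βp α t) t := by
    intro t ht hne hd
    refine HasDerivAt.sub ?_ (hasDerivAt_integral_div_betaPW hβm hβp hw a hne)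
    exact ((hud t ht hne).hasDerivAt.sub hd.hasDerivAt).congr_of_eventuallyEq
      (Filter.eventually_of_mem (Icc_mem_nhds ht.1 ht.2) heq)
  have hsub : ∀ {i}, i ≤ N → ∀ t ∈ Ioo (x (i - 1)) (x i), t ∈ Ioo a b := fun hiN t ht =>
    ⟨(hM.left_le (by omega)).trans_lt ht.1, ht.2.trans_le (hM.le_right hiN)⟩
  have hpow : ∀ i, 1 ≤ i → i ≤ N → ∀ y, |y| ≤ x i - x (i - 1) → |y| ^ p ≤ hm ^ p :=
    fun i hi hiN y hy => by
      have := hy.trans (hh i hi hiN)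
      gcongr
  have hexQ : ∀ i, 1 ≤ i → i ≤ N → ∃ Q : Polynomial ℝ, Q.natDegree ≤ p - 1 ∧
      ∀ t ∈ Ioo (x (i - 1)) (x i), t ≠ α →
        |betaPW βm βp α t * deriv u t - Q.eval t| ≤ max βm βp * W * hm ^ p := by
    intro i hi hiN
    have hlt := hM.element_lt hi hiN
    have fin : ∀ {L R b₀ : ℝ}, L < R → SmoothPiece m L R W u → L ≤ x (i - 1) → x i ≤ R →
        0 < b₀ → b₀ ≤ max βm βp →
        (∀ t ∈ Ioo (x (i - 1)) (x i), betaPW βm βp α t = b₀) →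
        ∃ Q : Polynomial ℝ, Q.natDegree ≤ p - 1 ∧
      ∀ t ∈ Ioo (x (i - 1)) (x i), t ≠ α →
        |betaPW βm βp α t * deriv u t - Q.eval t| ≤ max βm βp * W * hm ^ p := by
      intro L R b₀ hLR hus hL hR hb0 hbm hb
      refine ⟨Polynomial.C b₀ * taylorPoly (fun n => iteratedDerivWithin (n + 1) u (Icc L R)
        (x (i - 1))) (x (i - 1)) (p - 1), (Polynomial.natDegree_C_mul_le _ _).trans
          (natDegree_taylorPoly_le _ _ _), fun t ht _ => ?_⟩
      have h1 := hus.abs_deriv_sub_taylorPoly_le hLR (n := p - 1) (by omega)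
        (x₀ := x (i - 1)) ⟨hL, hlt.le.trans hR⟩ ⟨hL.trans_lt ht.1, ht.2.trans_le hR⟩
      rw [Nat.sub_add_cancel (by omega)] at h1
      rw [hb t ht, Polynomial.eval_mul, Polynomial.eval_C, ← mul_sub, abs_mul, abs_of_pos hb0,
        mul_assoc]
      have h2 := hpow i hi hiN (t - x (i - 1)) (by
        rw [abs_of_pos (sub_pos.2 ht.1)]
        linarith [ht.2])
      exact mul_le_mul hbm (h1.trans (mul_le_mul_of_nonneg_left h2 hW)) (abs_nonneg _) hhi.le
    rcases lt_trichotomy i k with h | rfl | h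
    · have h2 : x i < α := (mesh_mono hM.step (show i ≤ k - 1 by omega)
        (by have := hM.k_le; omega)).trans_lt hM.lt_interface
      exact fin hα.1 hum (hM.left_le (by omega)) h2.le hβm (le_max_left _ _)
        fun t ht => betaPW_of_lt (ht.2.trans h2)
    · obtain ⟨Q, hQ, hQb⟩ := exists_interface_polynomial hβm hβp (n := p - 1) hα
        (hM.left_le (i := i - 1) (by omega)) (hM.le_right hiN) hM.lt_interface.le
        hM.interface_lt.le hum hup (by omega) hjump
      refine ⟨Q, hQ, fun t ht hne => (hQb t ht hne).trans ?_⟩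
      rw [Nat.sub_add_cancel (by omega)]
      have h3 := hh i hi hiN
      have h4 := sub_pos.2 hlt
      gcongr
    · have h2 : α < x (i - 1) := hM.interface_lt.trans_le
        (mesh_mono hM.step (show k ≤ i - 1 by omega) (by omega))
      exact fin hα.2 hup h2.le (hM.le_right hiN) hβp (le_max_right _ _)
        fun t ht => betaPW_of_gt (h2.trans ht.1)
  set δ := max βm βp * W * hm ^ p + (|γ| + c * (b - a)) * E with hδ
  have hba : 0 < b - a := sub_pos.2 hab
  have hδ0 : 0 ≤ δ := by positivity
  have hcrude : ∀ i, 1 ≤ i → i ≤ N → ∀ t ∈ Icc (x (i - 1)) (x i),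
      |ρ t - ρ (x (i - 1))| ≤ (1 + Λ) * δ / min βm βp * hm := by
    intro i hi hiN t ht
    obtain ⟨Q, hQ, hQb⟩ := hexQ i hi hiN
    obtain ⟨s, hs, hsd⟩ := huT.exists_flux_polynomial (by omega) hM.step hM.one_le_k hM.k_le
      hM.lt_interface hM.interface_lt hi hiN
    have hres := abs_residual_le (α := α) (K := K)
      (v := fun t => betaPW βm βp α t * deriv u t) (g := fun t => betaPW βm βp α t * deriv uT t)
      (Z := fun t => γ * e t + c * S t) (δ₂ := (|γ| + c * (b - a)) * E)
      (fun B δ hB hδ hBG => hΛ _ _ δ _ _ B (hM.element_lt hi hiN) (hM.weight_pos i hi hiN)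
        (hM.quad i hi hiN) hB hδ hBG)
      (by positivity) (by positivity) hs hQ hQb
      (fun y hy _ => by
        have hy' := Ioo_subset_Icc_self (hsub hiN y hy)
        refine (abs_add_le _ _).trans ?_
        rw [abs_mul, abs_mul, abs_of_pos hc, add_mul, mul_assoc c]
        have := hE y hy'
        have := hSb y hy'
        gcongr)
      (fun y hy hne => (hsd y hy hne).2) (hM.gauss_mem i hi hiN)
      (fun j hj => by
        have := hG i hi hiN j hj
        linarith)
    have h1 := abs_sub_le_of_abs_deriv_le_off_point (α := α) (M := (1 + Λ) * δ / min βm βp) ht.1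
      hρc.continuousOn (fun y hy hne => by
        have hy' : y ∈ Ioo (x (i - 1)) (x i) := ⟨hy.1, hy.2.trans_le ht.2⟩
        exact hρd y (hsub hiN y hy') hne (hsd y hy' hne).1)
      (fun y hy hne => by
        have hy' : y ∈ Ioo (x (i - 1)) (x i) := ⟨hy.1, hy.2.trans_le ht.2⟩
        have hb := betaPW_pos hβm hβp α y
        have h2 : deriv u y - deriv uT y - (K + γ * e y + c * S y) / betaPW βm βp α y
          = (betaPW βm βp α y * deriv u y - betaPW βm βp α y * deriv uT y
            - (K + (γ * e y + c * S y))) / betaPW βm βp α y := by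
          field_simp
          ring
        rw [h2, abs_div, abs_of_pos hb]
        exact div_le_div₀ (by positivity) (hres y hy' hne) hlo (min_le_betaPW _ _ _ _))
    refine h1.trans (mul_le_mul_of_nonneg_left ?_ (by positivity))
    linarith [ht.2, hh i hi hiN]
  have hfine : ∀ i, 1 ≤ i → i ≤ N → i ≠ k → |ρ (x i) - ρ (x (i - 1))|
      ≤ 2 * ((max βm βp + |γ| + c) * (W * hm ^ (p + 1))) / min βm βp * (x i - x (i - 1)) := by
    intro i hi hiN hik
    have hlt := hM.element_lt hi hiN
    obtain ⟨q, hq, hvq⟩ := huT.2.2.2.1 i hi hiN hik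
    have hqd : ∀ t ∈ Ioo (x (i - 1)) (x i),
        HasDerivAt uT ((Polynomial.derivative q).eval t) t := fun t ht =>
      (q.hasDerivAt t).congr_of_eventuallyEq
        (Filter.eventually_of_mem (Icc_mem_nhds ht.1 ht.2) hvq)
    have key : ∀ {L R b₀ : ℝ}, SmoothPiece m L R W u → L ≤ x (i - 1) → x i ≤ R →
        (∀ t ∈ Icc (x (i - 1)) (x i), betaPW βm βp α t = b₀) → |ρ (x i) - ρ (x (i - 1))|
      ≤ 2 * ((max βm βp + |γ| + c) * (W * hm ^ (p + 1))) / min βm βp * (x i - x (i - 1)) := by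
      intro L R b₀ hus hL hR hb
      refine abs_sub_le_of_regular_element (K := K) hβm hβp hc hp hpm hus hlt hL hR hb
        (hh i hi hiN) hm1 (hM.weight_pos i hi hiN) (hM.quad i hi hiN)
        (fun j hj => (hM.gauss_mem i hi hiN j hj).1) hq (fun t ht => ?_) hS hρc
        (fun t ht hne => ?_) (fun j hj => ?_)
      · rw [heq t ⟨(hM.left_le (by omega)).trans ht.1, ht.2.trans (hM.le_right hiN)⟩, hvq t ht]
      · rw [← (hqd t ht).deriv]
        exact hρd t (hsub hiN t ht) hne (hqd t ht).differentiableAt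
      · have h1 := (hM.gauss_mem i hi hiN j hj).1
        rw [← (hqd _ h1).deriv, ← hb _ (Ioo_subset_Icc_self h1)]
        exact hG i hi hiN j hj
    rcases hik.lt_or_gt with h | h
    · have h2 : x i < α := (mesh_mono hM.step (show i ≤ k - 1 by omega)
        (by have := hM.k_le; omega)).trans_lt hM.lt_interface
      exact key hum (hM.left_le (by omega)) h2.le fun t ht => betaPW_of_lt (ht.2.trans_lt h2)
    · have h2 : α < x (i - 1) := hM.interface_lt.trans_le
        (mesh_mono hM.step (show k ≤ i - 1 by omega) (by omega))
      exact key hup h2.le (hM.le_right hiN) fun t ht => betaPW_of_gt (h2.trans_le ht.1)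
  have h0 : ρ (x 0) = 0 := by simp [hρ, hM.left, hea]
  have := abs_le_of_mesh_increments (k := k) hM.one_le_N hM.step (by positivity) (by positivity)
    h0 hfine hcrude
  rwa [hM.left, hM.right] at this

end IsGaussMesh

lemma MemW.smoothPiece {m : ℕ} {a b α βm βp : ℝ} {u : ℝ → ℝ} (hα : α ∈ Ioo a b)
    (hu : MemW m a b α βm βp u) :
    SmoothPiece m a α (wnorm m a b α u) u ∧ SmoothPiece m α b (wnorm m a b α u) u :=
  ⟨(ContDiffOn.smoothPiece hα.1 hu.2.2.2.1).mono (le_max_left _ _),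
    (ContDiffOn.smoothPiece hα.2 hu.2.2.2.2.1).mono (le_max_right _ _)⟩

/-- under the hypotheses of the superconvergence theorem, the flux is
superconvergent at the generalized Gauss points:
`|β(g_{i,j}) (u′(g_{i,j}) − u_T′(g_{i,j}))| ≤ C h^{p+1} ‖u‖_{2p+1,∞}`. -/
theorem stmt_17 (p : ℕ) (hp : 2 ≤ p) (βm βp γ c κ σ d : ℝ)
    (hβm : 0 < βm) (hβp : 0 < βp) (hc : 0 < c) (hκ : 0 < κ) (hσ : 0 < σ) (hd : 0 < d) :
    ∃ h₀ C : ℝ, 0 < h₀ ∧ 0 < C ∧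
    (∀ (N k : ℕ) (a b α hm : ℝ) (x : ℕ → ℝ) (g A : ℕ → ℕ → ℝ),
    b - a = d →
    1 ≤ N →
    1 ≤ k →
    k ≤ N →
    a < b →
    x 0 = a →
    x N = b →
    (∀ i, i < N → x i < x (i + 1)) →
    x (k - 1) < α →
    α < x k →
    (∀ i ∈ Finset.Icc 1 N, ∀ j ∈ Finset.Icc 1 p,
      x (i - 1) < g i j ∧ g i j < x i ∧ g i j ≠ α) →
    (∀ i ∈ Finset.Icc 1 N, ∀ j, 1 ≤ j → j < p → g i j < g i (j + 1)) →
    (∀ i, 1 ≤ i → i < N → g i (p + 1) = g (i + 1) 1) →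
    (∀ i ∈ Finset.Icc 1 N, ∀ j ∈ Finset.Icc 1 p, 0 < A i j) →
    (∀ i ∈ Finset.Icc 1 N, ∀ F : Polynomial ℝ, F.natDegree ≤ 2 * p - 1 →
      ∑ j ∈ Finset.Icc 1 p, A i j * F.eval (g i j)
        = ∫ t in (x (i - 1))..(x i), F.eval t / betaPW βm βp α t) →
    (∀ i ∈ Finset.Icc 1 N, ∀ j ∈ Finset.Icc 1 p, κ * (x i - x (i - 1)) ≤ A i j) →
    (∀ i ∈ Finset.Icc 1 N, ∀ i' ∈ Finset.Icc 1 N,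
      x i - x (i - 1) ≤ σ * (x i' - x (i' - 1))) →
    (∀ i ∈ Finset.Icc 1 N, x i - x (i - 1) ≤ hm) →
    hm ≤ h₀ →
    ∀ (f u uT : ℝ → ℝ),
    ContinuousOn f (Set.Ioo a α ∪ Set.Ioo α b) →
    (∃ Mf : ℝ, ∀ t ∈ Set.Icc a b, |f t| ≤ Mf) →
    MemW (2 * p + 1) a b α βm βp u →
    (∀ t, t ∈ Set.Ioo a α ∪ Set.Ioo α b →
      -(betaPW βm βp α t * iteratedDeriv 2 u t) + γ * deriv u t + c * u t = f t) →
    MemUT p N k a b α βm βp x uT →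
    (∀ i, 1 ≤ i → i ≤ N → ∀ j, 1 ≤ j → j ≤ (if i < N then p else p - 1) →
      betaPW βm βp α (g i j) * deriv uT (g i j)
        - betaPW βm βp α (g i (j + 1)) * deriv uT (g i (j + 1))
        + (∫ t in (g i j)..(g i (j + 1)), (γ * deriv uT t + c * uT t))
        = ∫ t in (g i j)..(g i (j + 1)), f t) →
    ∀ i ∈ Finset.Icc 1 N, ∀ j ∈ Finset.Icc 1 p,
      |betaPW βm βp α (g i j) * (deriv u (g i j) - deriv uT (g i j))|
        ≤ C * hm ^ (p + 1) * wnorm (2 * p + 1) a b α u) := by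
  obtain ⟨Λ, hΛ0, hΛ⟩ := exists_lebesgue_constant hβm hβp p
  obtain ⟨Cs, hCs0, hstab⟩ := exists_stability_constant hβm hβp γ hc hd
  have hlo := lt_min hβm hβp
  have hhi : 0 < max βm βp := lt_max_of_lt_left hβm
  set C₁ := 2 * (max βm βp + |γ| + c) / min βm βp * d
    + 2 * ((1 + Λ) * max βm βp) / min βm βp with hC₁
  set C₂ := 2 * ((1 + Λ) * (|γ| + c * d)) / min βm βp with hC₂
  have hC₁0 : 0 < C₁ := by positivity
  have hC₂0 : 0 < C₂ := by positivity
  refine ⟨min 1 (1 / (2 * (Cs * C₂))), 2 * (Cs * C₁) * (1 + |γ| + c * d), by positivity,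
    by positivity, ?_⟩
  intro N k a b α hm x g A hba _ hk hkN hab hxa hxb hx hkα hαk hg hglt hgnext hA hquad _ _ hh hmh₀
    f u uT _ hfb hu hode huT hscheme i hi j hj
  obtain ⟨Mf, hMf⟩ := hfb
  have hmem : ∀ {i}, 1 ≤ i → i ≤ N → i ∈ Finset.Icc 1 N := fun h h' => Finset.mem_Icc.2 ⟨h, h'⟩
  have hM : IsGaussMesh p N k a b α βm βp x g A :=
    { one_le_k := hk
      k_le := hkN
      left := hxa
      right := hxb
      step := hx
      lt_interface := hkα
      interface_lt := hαk
      gauss_mem := fun i h h' j hj => by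
        obtain ⟨h1, h2, h3⟩ := hg i (hmem h h') j hj
        exact ⟨⟨h1, h2⟩, h3⟩
      gauss_lt := fun i h h' => hglt i (hmem h h')
      gauss_next := hgnext
      weight_pos := fun i h h' => hA i (hmem h h')
      quad := fun i h h' => hquad i (hmem h h') }
  obtain ⟨hum, hup⟩ := hu.smoothPiece hM.interface_mem
  set W := wnorm (2 * p + 1) a b α u
  have hW := hum.nonneg hM.interface_mem.1
  have hm0 : 0 < hm := (sub_pos.2 (hM.element_lt hk hkN)).trans_le (hh k (hmem hk hkN))
  obtain ⟨ue, huec, hueq⟩ := exists_continuous_extension hab.le hu.1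
  obtain ⟨uTe, huTec, huTeq⟩ := exists_continuous_extension hab.le huT.1
  have ha := left_mem_Icc.2 hab.le
  have hb := right_mem_Icc.2 hab.le
  obtain ⟨K, hK⟩ := hM.exists_flux_error_eq hβm hβp (by omega) (by omega) hMf hu hode huT hscheme
    huec hueq huTec huTeq
  have hec : Continuous fun t => ue t - uTe t := huec.sub huTec
  obtain ⟨t₀, ht₀, hmax⟩ := isCompact_Icc.exists_isMaxOn (nonempty_Icc.2 hab.le)
    (hec.abs.continuousOn (s := Icc a b))
  set E := |ue t₀ - uTe t₀| with hE
  have hdefect := hM.abs_defect_le (K := K) (E := E) hβm hβp hc hp (by omega) hΛ0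
    (fun i h h' => hh i (hmem h h')) (hmh₀.trans (min_le_left _ _)) (hΛ α) hum hup hu.2.2.2.2.2
    huT hec
    (by rw [hueq a ha, huTeq a ha, hu.2.1, huT.2.1, sub_zero])
    (fun t ht => by rw [hueq t ht, huTeq t ht]) (fun t ht => hmax ht) hK
  obtain ⟨hKb, heb⟩ := hstab a b α K _ _ hba hec
    (by rw [hueq b hb, huTeq b hb, hu.2.2.1, huT.2.2.1, sub_zero]) hdefect
  have hr : 2 * ((max βm βp + |γ| + c) * (W * hm ^ (p + 1))) / min βm βp * (b - a)
      + 2 * ((1 + Λ) * (max βm βp * W * hm ^ p + (|γ| + c * (b - a)) * E) / min βm βp * hm)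
      = C₁ * (hm ^ (p + 1) * W) + C₂ * hm * E := by
    rw [hC₁, hC₂, hba]
    ring
  rw [hr] at hKb heb
  set X := hm ^ (p + 1) * W with hX
  have hsmall : Cs * C₂ * hm ≤ 1 / 2 := by
    have := mul_le_mul_of_nonneg_left (hmh₀.trans (min_le_right _ _)) (mul_pos hCs0 hC₂0).le
    refine this.trans_eq ?_
    field_simp
  have hE0 : 0 ≤ E := abs_nonneg _
  have habs : Cs * (C₁ * X + C₂ * hm * E) ≤ Cs * C₁ * X + 1 / 2 * E := by
    have := mul_le_mul_of_nonneg_right hsmall hE0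
    linarith
  have hEb : E ≤ 2 * (Cs * C₁) * X := by
    have := heb t₀ ht₀
    linarith
  have hKb' : |K| ≤ 2 * (Cs * C₁) * X := by linarith
  rw [Finset.mem_Icc] at hi
  have hgab := hM.gauss_mem_Ioo hi.1 hi.2 hj
  have hSb : |∫ y in a..g i j, (ue y - uTe y)| ≤ d * E := by
    have h := intervalIntegral.norm_integral_le_of_norm_le_const (a := a) (b := g i j) (C := E)
      (f := fun y => ue y - uTe y) (fun y hy => by
        rw [uIoc_of_le hgab.1.le] at hy
        exact hmax ⟨hy.1.le, hy.2.trans hgab.2.le⟩)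
    rw [Real.norm_eq_abs, abs_of_pos (sub_pos.2 hgab.1), mul_comm] at h
    refine h.trans (mul_le_mul_of_nonneg_right ?_ hE0)
    linarith [hgab.2]
  rw [hK i hi.1 hi.2 j hj]
  calc |K + γ * (ue (g i j) - uTe (g i j)) + c * ∫ y in a..g i j, (ue y - uTe y)|
      ≤ |K| + |γ| * E + c * (d * E) := by
        refine (abs_add_three _ _ _).trans ?_
        rw [abs_mul, abs_mul, abs_of_pos hc]
        have h1 : |ue (g i j) - uTe (g i j)| ≤ E := hmax (Ioo_subset_Icc_self hgab)
        gcongr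
    _ ≤ 2 * (Cs * C₁) * X + |γ| * (2 * (Cs * C₁) * X) + c * (d * (2 * (Cs * C₁) * X)) := by gcongr
    _ = 2 * (Cs * C₁) * (1 + |γ| + c * d) * hm ^ (p + 1) * W := by
        rw [hX]
        ring
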